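/- Full regularity and polynomial growth of the solution A of the integral equation: the unique solution A(x,y,w) of A(x,y,w) + ∫₀^x A(x,s,w)Φ(s,y,w)ds + Φ(x,y,w) = 0, defined on Δ × W where Δ = {(x,y) : 0 ≤ y ≤ x} and W = {Re z > 0}, is continuous in (x,y) ∈ Δ and holomorphic in w ∈ W (so the equation holds for all (x,y) ∈ Δ, not only almost everywhere); the map x ↦ A(x,·,w) ∈ L²_y([0,x]) is continuously differentiable, the map x ↦ A(x,x,w) is continuously differentiable; and for every X ≥ 1 and w ∈ W: sup_{0 ≤ y ≤ x ≤ X} |A(x,y,w)| ≤ C(X)(1+|w|)^α, sup_{x ≤ X} ‖(∂A/∂x)(x,·,w)‖_{L²([0,x])} ≤ C(X)(1+|w|)^α, and sup_{x ≤ X} |d/dx A(x,x,w)| ≤ C(X)(1+|w|)^α, where the exponent α does not depend on X. -/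

import Mathlib

open MeasureTheory Set Filter

noncomputable section

/-- The kernel `Φ(x,y,w) = ∫₀^∞ (sin kx / k)(sin ky / k)(√(k²+w) − k)(2k/π) dk`
(principal branch of the complex square root). -/
def Phi (x y : ℝ) (w : ℂ) : ℂ :=
  ∫ k in Ioi (0:ℝ),
    ((Real.sin (k * x) / k : ℝ) : ℂ) * ((Real.sin (k * y) / k : ℝ) : ℂ) *
      (((k : ℂ) ^ 2 + w) ^ ((1 : ℂ) / 2) - (k : ℂ)) * ((2 * k / Real.pi : ℝ) : ℂ)

/-! ### Square root -/

/-- the square root `√(k²+w)` -/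
def rz (w : ℂ) (k : ℝ) : ℂ := ((k : ℂ) ^ 2 + w) ^ ((1 : ℂ) / 2)

lemma rz_sq (w : ℂ) (k : ℝ) : rz w k ^ 2 = (k : ℂ) ^ 2 + w := by
  simp [rz]

lemma rz_base_re {w : ℂ} (hw : 0 < w.re) (k : ℝ) : 0 < ((k : ℂ) ^ 2 + w).re := by
  have : ((k : ℂ) ^ 2 + w).re = k ^ 2 + w.re := by
    simp [pow_two]
  rw [this]; positivity

lemma rz_re_nonneg {w : ℂ} (hw : 0 < w.re) (k : ℝ) : 0 ≤ (rz w k).re := by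
  have h0 := rz_base_re hw k
  have hne : ((k : ℂ) ^ 2 + w) ≠ 0 := by
    intro h; rw [h] at h0; simp at h0
  rw [rz, Complex.cpow_def_of_ne_zero hne, Complex.exp_re]
  have hi : (Complex.log ((k : ℂ) ^ 2 + w) * (1 / 2)).im = Complex.arg ((k : ℂ) ^ 2 + w) / 2 := by
    have : (1 / 2 : ℂ) = ((1 / 2 : ℝ) : ℂ) := by push_cast; rfl
    rw [this, Complex.im_mul_ofReal, Complex.log_im]; ring
  rw [hi]
  have h1 := Complex.arg_le_pi ((k : ℂ) ^ 2 + w)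
  have h2 := Complex.neg_pi_lt_arg ((k : ℂ) ^ 2 + w)
  exact mul_nonneg (Real.exp_pos _).le
    (Real.cos_nonneg_of_mem_Icc ⟨by linarith, by linarith⟩)

lemma rz_re_sq {w : ℂ} (k : ℝ) : k ^ 2 + w.re ≤ (rz w k).re ^ 2 := by
  have h := congrArg Complex.re (rz_sq w k)
  rw [pow_two, pow_two] at h
  simp at h
  nlinarith [sq_nonneg (rz w k).im]

lemma rz_re_ge {w : ℂ} (hw : 0 < w.re) (k : ℝ) : k ≤ (rz w k).re := by
  have := rz_re_sq (w := w) k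
  nlinarith [rz_re_nonneg hw k]

lemma rz_re_ge' {w : ℂ} (hw : 0 < w.re) (k : ℝ) : Real.sqrt w.re ≤ (rz w k).re := by
  have := rz_re_sq (w := w) k
  apply Real.sqrt_le_iff.2 ⟨rz_re_nonneg hw k, by nlinarith⟩

lemma rz_cont {w : ℂ} (hw : 0 < w.re) : Continuous (rz w) := by
  unfold rz
  refine Continuous.cpow (by fun_prop) continuous_const ?_
  intro k
  exact Or.inl (rz_base_re hw k)

lemma rz_norm_sq {w : ℂ} (hw : 0 < w.re) (k : ℝ) : ‖w‖ ≤ ‖rz w k‖ ^ 2 := by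
  rw [← norm_pow, rz_sq]
  have : ((k : ℂ) ^ 2 + w) = ((k ^ 2 : ℝ) : ℂ) + w := by push_cast; rfl
  rw [this, ← sq_le_sq₀ (norm_nonneg _) (norm_nonneg _), ← Complex.normSq_eq_norm_sq,
    ← Complex.normSq_eq_norm_sq, Complex.normSq_apply, Complex.normSq_apply]
  simp only [Complex.add_re, Complex.ofReal_re, Complex.add_im, Complex.ofReal_im]
  nlinarith [sq_nonneg k, mul_nonneg (sq_nonneg k) hw.le, sq_nonneg (k ^ 2)]

lemma rz_add_norm_ge {w : ℂ} (hw : 0 < w.re) {k : ℝ} (hk : 0 < k) : 2 * k ≤ ‖rz w k + k‖ := by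
  have h := Complex.re_le_norm (rz w k + k)
  simp at h
  linarith [rz_re_ge hw k]

lemma rz_add_norm_sq {w : ℂ} (hw : 0 < w.re) {k : ℝ} (hk : 0 < k) : ‖w‖ ≤ ‖rz w k + k‖ ^ 2 := by
  refine (rz_norm_sq hw k).trans ?_
  rw [← Complex.normSq_eq_norm_sq, ← Complex.normSq_eq_norm_sq, Complex.normSq_apply,
    Complex.normSq_apply]
  simp only [Complex.add_re, Complex.ofReal_re, Complex.add_im, Complex.ofReal_im]
  nlinarith [rz_re_nonneg hw k]

lemma rz_add_ne {w : ℂ} (hw : 0 < w.re) {k : ℝ} (hk : 0 < k) : rz w k + k ≠ 0 := by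
  intro h
  have := rz_add_norm_ge hw hk
  rw [h] at this; simp at this; linarith

/-- the weight `√(k²+w) - k` -/
def mw (w : ℂ) (k : ℝ) : ℂ := rz w k - k

lemma mw_mul (w : ℂ) (k : ℝ) : mw w k * (rz w k + k) = w := by
  have := rz_sq w k
  unfold mw; linear_combination this

lemma mw_bound {w : ℂ} (hw : 0 < w.re) {k : ℝ} (hk : 0 < k) :
    ‖mw w k‖ ≤ (1 + ‖w‖) / (1 + k) := by
  have h1 := congrArg norm (mw_mul w k)
  rw [norm_mul] at h1
  have h2 := rz_add_norm_ge hw hk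
  have h3 := rz_add_norm_sq hw hk
  set a := ‖mw w k‖
  set b := ‖rz w k + k‖
  have hw0 : 0 < ‖w‖ := by
    have := Complex.re_le_norm w; linarith
  have ha : 0 ≤ a := norm_nonneg _
  have hb : 0 < b := by linarith
  rw [le_div_iff₀ (by linarith)]
  have h4 : a ^ 2 ≤ ‖w‖ := by
    have : a ^ 2 * ‖w‖ ≤ ‖w‖ * ‖w‖ := by
      calc a ^ 2 * ‖w‖ ≤ a ^ 2 * b ^ 2 := by gcongr
        _ = ‖w‖ * ‖w‖ := by rw [← h1]; ring
    exact le_of_mul_le_mul_right this hw0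
  have h5 : a * k ≤ ‖w‖ / 2 := by nlinarith
  nlinarith [sq_nonneg (a - 1)]

lemma mw_re {w : ℂ} (hw : 0 < w.re) (k : ℝ) : 0 ≤ (mw w k).re := by
  have := rz_re_ge hw k
  simp [mw]; linarith

lemma mw_cont {w : ℂ} (hw : 0 < w.re) : Continuous (mw w) := by
  unfold mw
  exact (rz_cont hw).sub Complex.continuous_ofReal

/-- the weight of the `w`-derivative -/
def mw1 (w : ℂ) (k : ℝ) : ℂ := 1 / (2 * rz w k)

/-- the weight of the `w`-remainder -/
def mw2 (w w' : ℂ) (k : ℝ) : ℂ := - 1 / (2 * rz w k * (rz w' k + rz w k) ^ 2)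

lemma rz_lower {w : ℂ} (hw : 0 < w.re) {k : ℝ} (hk : 0 < k) :
    (1 + k) / (1 + 1 / Real.sqrt w.re) / 2 ≤ (rz w k).re := by
  have h1 := rz_re_ge hw k
  have h2 := rz_re_ge' hw k
  have hs : 0 < Real.sqrt w.re := Real.sqrt_pos.2 hw
  rw [div_div, div_le_iff₀ (by positivity)]
  have h3 : 1 ≤ (rz w k).re * (1 / Real.sqrt w.re) := by
    rw [mul_one_div, le_div_iff₀ hs]; linarith
  have h4 : 0 ≤ (rz w k).re := by linarith
  nlinarith

lemma mw1_bound {w : ℂ} (hw : 0 < w.re) {k : ℝ} (hk : 0 < k) :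
    ‖mw1 w k‖ ≤ (1 + 1 / Real.sqrt w.re) / (1 + k) := by
  have h := rz_lower hw hk
  have h' := Complex.re_le_norm (rz w k)
  have hs : 0 < Real.sqrt w.re := Real.sqrt_pos.2 hw
  have hp : 0 < (1 + k) / (1 + 1 / Real.sqrt w.re) / 2 := by positivity
  unfold mw1
  rw [norm_div, norm_mul, norm_one, Complex.norm_ofNat]
  calc 1 / (2 * ‖rz w k‖) ≤ 1 / (2 * ((1 + k) / (1 + 1 / Real.sqrt w.re) / 2)) := by
        gcongr; linarith
    _ = _ := by field_simp

lemma mw2_bound {w : ℂ} (hw : 0 < w.re) {w' : ℂ} (hw' : 0 < w'.re) {k : ℝ} (hk : 0 < k) :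
    ‖mw2 w w' k‖ ≤ ((1 + 1 / Real.sqrt w.re) / w.re) / (1 + k) := by
  have h := mw1_bound hw hk
  have h2 : Real.sqrt w.re ≤ ‖rz w' k + rz w k‖ := by
    refine le_trans ?_ (Complex.re_le_norm _)
    rw [Complex.add_re]
    linarith [rz_re_nonneg hw' k, rz_re_ge' hw k]
  have h3 : w.re ≤ ‖rz w' k + rz w k‖ ^ 2 := by
    calc w.re = Real.sqrt w.re ^ 2 := (Real.sq_sqrt hw.le).symm
      _ ≤ _ := by gcongr
  have : mw2 w w' k = - mw1 w k / (rz w' k + rz w k) ^ 2 := by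
    unfold mw2 mw1; rw [neg_div, neg_div, div_div]
  rw [this, norm_div, norm_neg, norm_pow]
  calc ‖mw1 w k‖ / ‖rz w' k + rz w k‖ ^ 2 ≤ ((1 + 1 / Real.sqrt w.re) / (1 + k)) / w.re := by
        gcongr
    _ = _ := by field_simp

lemma rz_ne {w : ℂ} (hw : 0 < w.re) (k : ℝ) : rz w k ≠ 0 := by
  intro h
  have := rz_sq w k
  have h0 := rz_base_re hw k
  rw [← this, h] at h0
  simp at h0

lemma rz_add_ne' {w : ℂ} (hw : 0 < w.re) {w' : ℂ} (hw' : 0 < w'.re) (k : ℝ) :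
    rz w' k + rz w k ≠ 0 := by
  intro h
  have h1 := congrArg Complex.re h
  rw [Complex.add_re, Complex.zero_re] at h1
  have hs : 0 < Real.sqrt w.re := Real.sqrt_pos.2 hw
  linarith [rz_re_nonneg hw' k, rz_re_ge' hw k]

lemma mw_taylor {w : ℂ} (hw : 0 < w.re) {w' : ℂ} (hw' : 0 < w'.re) (k : ℝ) :
    mw w' k - mw w k - (w' - w) * mw1 w k = (w' - w) ^ 2 * mw2 w w' k := by
  have h1 := rz_ne hw k
  have h2 := rz_add_ne' hw hw' k
  have h3 : w' - w = rz w' k ^ 2 - rz w k ^ 2 := by rw [rz_sq, rz_sq]; ring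
  rw [h3]
  unfold mw mw1 mw2
  field_simp
  ring

lemma mw1_cont {w : ℂ} (hw : 0 < w.re) : Continuous (mw1 w) := by
  unfold mw1
  have := rz_cont hw
  refine continuous_const.div (by fun_prop) ?_
  intro k; exact mul_ne_zero two_ne_zero (rz_ne hw k)

lemma mw2_cont {w : ℂ} (hw : 0 < w.re) {w' : ℂ} (hw' : 0 < w'.re) : Continuous (mw2 w w') := by
  unfold mw2
  have := rz_cont hw
  have := rz_cont hw'
  refine continuous_const.div (by fun_prop) ?_
  intro k
  have hfin := pow_ne_zero 2 (rz_add_ne' hw hw' k)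
  exact mul_ne_zero (mul_ne_zero two_ne_zero (rz_ne hw k)) hfin

/-- the weight of the regular part -/
def rho (w : ℂ) (k : ℝ) : ℂ := - w ^ 2 / (Real.pi * (rz w k + k) ^ 2)

lemma rho_bound {w : ℂ} (hw : 0 < w.re) {k : ℝ} (hk : 0 < k) :
    ‖rho w k‖ ≤ (1 + ‖w‖) ^ 2 * (1 + k ^ 2)⁻¹ := by
  have h2 := rz_add_norm_ge hw hk
  have h3 := rz_add_norm_sq hw hk
  unfold rho
  rw [norm_div, norm_neg, norm_pow, norm_mul, norm_pow, Complex.norm_real, Real.norm_eq_abs,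
    abs_of_pos Real.pi_pos, ← div_eq_mul_inv]
  set b := ‖rz w k + k‖
  have hb : 0 < b := by linarith
  rw [div_le_div_iff₀ (by positivity) (by positivity)]
  have hw0 : 0 ≤ ‖w‖ := norm_nonneg _
  have h4 : ‖w‖ ^ 2 * (1 + k ^ 2) ≤ (1 + ‖w‖) ^ 2 * b ^ 2 := by
    have h5 : k ^ 2 ≤ b ^ 2 := by gcongr; linarith
    have h6 : ‖w‖ ^ 2 * k ^ 2 ≤ ‖w‖ ^ 2 * b ^ 2 := by gcongr
    have h7 : ‖w‖ * ‖w‖ ≤ ‖w‖ * b ^ 2 := by gcongr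
    nlinarith [sq_nonneg b, mul_nonneg hw0 (sq_nonneg b)]
  refine h4.trans ?_
  have : (1:ℝ) ≤ Real.pi := by linarith [Real.pi_gt_three]
  calc (1 + ‖w‖) ^ 2 * b ^ 2 = (1 + ‖w‖) ^ 2 * (1 * b ^ 2) := by ring
    _ ≤ _ := by gcongr

lemma rho_eq {w : ℂ} (hw : 0 < w.re) {k : ℝ} (hk : 0 < k) :
    mw w k * (2 * k / Real.pi) = w / Real.pi + rho w k := by
  have h1 := rz_add_ne hw hk
  have h2 := rz_sq w k
  have hpi : (Real.pi : ℂ) ≠ 0 := by exact_mod_cast Real.pi_ne_zero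
  have h3 : w = rz w k ^ 2 - (k : ℂ) ^ 2 := by rw [h2]; ring
  unfold rho mw
  generalize rz w k = z at *
  subst h3
  field_simp
  ring

lemma rho_meas {w : ℂ} (hw : 0 < w.re) : Measurable (rho w) := by
  unfold rho
  have := (rz_cont hw).measurable
  fun_prop

/-! ### Generic kernels -/

/-- integrable majorant -/
def kb (k : ℝ) : ℝ := 1 / (Real.sqrt k * (1 + k))

lemma kb_nonneg {k : ℝ} (hk : 0 < k) : 0 ≤ kb k := by unfold kb; positivity

lemma kb_meas : Measurable kb := by unfold kb; fun_prop

lemma kb_int : IntegrableOn kb (Ioi 0) := by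
  have hu : Ioi (0:ℝ) = Ioc 0 1 ∪ Ioi 1 := (Ioc_union_Ioi_eq_Ioi zero_le_one).symm
  rw [hu]
  refine IntegrableOn.union ?_ ?_
  · have h : IntegrableOn (fun k : ℝ => k ^ (-(1/2) : ℝ)) (Ioc 0 1) := by
      rw [← intervalIntegrable_iff_integrableOn_Ioc_of_le zero_le_one]
      exact intervalIntegral.intervalIntegrable_rpow' (by norm_num)
    refine Integrable.mono' h kb_meas.aestronglyMeasurable ?_
    refine (ae_restrict_iff' measurableSet_Ioc).2 (Eventually.of_forall fun k hk => ?_)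
    rw [Real.norm_of_nonneg (kb_nonneg hk.1), Real.rpow_neg hk.1.le, ← Real.sqrt_eq_rpow, kb,
      ← one_div]
    have h1 : 0 < Real.sqrt k := Real.sqrt_pos.2 hk.1
    have := hk.1
    gcongr
    nlinarith
  · have h := integrableOn_Ioi_rpow_of_lt (a := (-(3/2) : ℝ)) (c := 1) (by norm_num) one_pos
    refine Integrable.mono' h kb_meas.aestronglyMeasurable ?_
    refine (ae_restrict_iff' measurableSet_Ioi).2 (Eventually.of_forall fun k hk => ?_)
    have hk0 : (0:ℝ) < k := lt_trans one_pos hk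
    rw [Real.norm_of_nonneg (kb_nonneg hk0), Real.rpow_neg hk0.le, kb,
      ← one_div]
    have h1 : 0 < Real.sqrt k := Real.sqrt_pos.2 hk0
    have h2 : k ^ (3/2 : ℝ) = Real.sqrt k * k := by
      rw [show (3/2 : ℝ) = 1/2 + 1 by norm_num, Real.rpow_add hk0, Real.rpow_one,
        ← Real.sqrt_eq_rpow]
    rw [h2]
    gcongr
    linarith

/-- total mass of the majorant -/
def kap : ℝ := ∫ k in Ioi (0:ℝ), kb k

lemma kap_nonneg : 0 ≤ kap :=
  setIntegral_nonneg measurableSet_Ioi fun _ hk => kb_nonneg hk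

lemma abs_sin_le_sqrt (t : ℝ) : |Real.sin t| ≤ Real.sqrt |t| := by
  apply Real.le_sqrt_of_sq_le
  have h1 := Real.abs_sin_le_one t
  have h2 : |Real.sin t| ≤ |t| := Real.abs_sin_le_abs
  nlinarith [abs_nonneg (Real.sin t), abs_nonneg t]

lemma abs_sin_sub_le (a b : ℝ) : |Real.sin a - Real.sin b| ≤ 2 * Real.sqrt |a - b| := by
  rw [Real.sin_sub_sin, abs_mul, abs_mul, abs_two]
  have h1 := Real.abs_cos_le_one ((a + b) / 2)
  have h2 := abs_sin_le_sqrt ((a - b) / 2)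
  have h3 : Real.sqrt |(a - b) / 2| ≤ Real.sqrt |a - b| := by
    apply Real.sqrt_le_sqrt
    rw [abs_div, abs_two]; linarith [abs_nonneg (a - b)]
  nlinarith [abs_nonneg (Real.sin ((a - b) / 2)), abs_nonneg (Real.cos ((a + b) / 2))]

/-- admissible weights -/
def Wt (μ : ℝ → ℂ) (M : ℝ) : Prop := Continuous μ ∧ 0 ≤ M ∧ ∀ k : ℝ, 0 < k → ‖μ k‖ ≤ M / (1 + k)

/-- integrand -/
def igd (μ : ℝ → ℂ) (x y k : ℝ) : ℂ :=
  ((Real.sin (k * x) / k : ℝ) : ℂ) * ((Real.sin (k * y) / k : ℝ) : ℂ) * μ k *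
    ((2 * k / Real.pi : ℝ) : ℂ)

/-- generic kernel -/
def Pk (μ : ℝ → ℂ) (x y : ℝ) : ℂ := ∫ k in Ioi (0:ℝ), igd μ x y k

lemma Phi_eq_Pk (x y : ℝ) (w : ℂ) : Phi x y w = Pk (mw w) x y := rfl

lemma igd_meas {μ : ℝ → ℂ} {M : ℝ} (h : Wt μ M) (y : ℝ) :
    Measurable (fun p : ℝ × ℝ => igd μ p.1 y p.2) := by
  unfold igd
  have := h.1.measurable
  have h1 : Measurable (fun p : ℝ × ℝ => μ p.2) := this.comp measurable_snd
  refine Measurable.mul (Measurable.mul ?_ h1) ?_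
  · fun_prop
  · fun_prop

lemma igd_meas1 {μ : ℝ → ℂ} {M : ℝ} (h : Wt μ M) (x y : ℝ) : Measurable (igd μ x y) := by
  unfold igd
  have h1 := h.1.measurable
  refine Measurable.mul (Measurable.mul ?_ h1) ?_
  · fun_prop
  · fun_prop

lemma igd_diff {μ : ℝ → ℂ} {M : ℝ} (h : Wt μ M) (x x' y : ℝ) {k : ℝ} (hk : 0 < k) :
    ‖igd μ x y k - igd μ x' y k‖ ≤ 2 * M * Real.sqrt |x - x'| * kb k := by
  have e : igd μ x y k - igd μ x' y k =
      (((Real.sin (k * x) - Real.sin (k * x')) * Real.sin (k * y) / k * (2 / Real.pi) : ℝ) : ℂ)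
        * μ k := by
    have hk' : (k : ℂ) ≠ 0 := by exact_mod_cast hk.ne'
    have hpi : (Real.pi : ℂ) ≠ 0 := by exact_mod_cast Real.pi_ne_zero
    unfold igd; push_cast; field_simp
  rw [e, norm_mul, Complex.norm_real, Real.norm_eq_abs, abs_mul, abs_div, abs_mul, abs_of_pos hk,
    abs_of_pos (by positivity : 0 < 2 / Real.pi)]
  have h1 : |Real.sin (k * x) - Real.sin (k * x')| ≤ 2 * (Real.sqrt k * Real.sqrt |x - x'|) := by
    refine (abs_sin_sub_le _ _).trans ?_
    rw [← mul_sub, abs_mul, Real.sqrt_mul (abs_nonneg k), abs_of_pos hk]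
  have h2 := Real.abs_sin_le_one (k * y)
  have h3 := h.2.2 k hk
  have h4 : 2 / Real.pi ≤ 1 := by
    rw [div_le_one Real.pi_pos]; linarith [Real.pi_gt_three]
  have hM := h.2.1
  have hs : 0 < Real.sqrt k := Real.sqrt_pos.2 hk
  calc |Real.sin (k * x) - Real.sin (k * x')| * |Real.sin (k * y)| / k * (2 / Real.pi) * ‖μ k‖
      ≤ 2 * (Real.sqrt k * Real.sqrt |x - x'|) * 1 / k * 1 * (M / (1 + k)) := by gcongr
    _ = 2 * M * Real.sqrt |x - x'| * (Real.sqrt k / (k * (1 + k))) := by field_simp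
    _ = _ := by
      unfold kb
      congr 1
      rw [div_eq_div_iff (by positivity) (by positivity)]
      nlinarith [Real.mul_self_sqrt hk.le]

lemma igd_zero (μ : ℝ → ℂ) (y k : ℝ) : igd μ 0 y k = 0 := by simp [igd]

lemma igd_bound {μ : ℝ → ℂ} {M : ℝ} (h : Wt μ M) (x y : ℝ) {k : ℝ} (hk : 0 < k) :
    ‖igd μ x y k‖ ≤ 2 * M * Real.sqrt |x| * kb k := by
  simpa [igd_zero] using igd_diff h x 0 y hk

lemma igd_int {μ : ℝ → ℂ} {M : ℝ} (h : Wt μ M) (x y : ℝ) : IntegrableOn (igd μ x y) (Ioi 0) := by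
  refine Integrable.mono' (kb_int.const_mul (2 * M * Real.sqrt |x|)) ?_ ?_
  · exact (igd_meas1 h x y).aestronglyMeasurable
  · exact (ae_restrict_iff' measurableSet_Ioi).2 (Eventually.of_forall fun k hk => igd_bound h x y hk)

lemma igd_symm (μ : ℝ → ℂ) (x y k : ℝ) : igd μ x y k = igd μ y x k := by unfold igd; ring

lemma Pk_symm (μ : ℝ → ℂ) (x y : ℝ) : Pk μ x y = Pk μ y x := by
  unfold Pk; simp_rw [igd_symm μ x y]

lemma Pk_diff {μ : ℝ → ℂ} {M : ℝ} (h : Wt μ M) (x x' y : ℝ) :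
    ‖Pk μ x y - Pk μ x' y‖ ≤ 2 * M * kap * Real.sqrt |x - x'| := by
  unfold Pk
  rw [← integral_sub (igd_int h x y) (igd_int h x' y)]
  calc _ ≤ ∫ k in Ioi (0:ℝ), 2 * M * Real.sqrt |x - x'| * kb k :=
        norm_integral_le_of_norm_le (kb_int.const_mul _)
          ((ae_restrict_iff' measurableSet_Ioi).2
            (Eventually.of_forall fun k hk => igd_diff h x x' y hk))
    _ = _ := by rw [integral_const_mul]; unfold kap; ring

lemma Pk_bound {μ : ℝ → ℂ} {M : ℝ} (h : Wt μ M) (x y : ℝ) :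
    ‖Pk μ x y‖ ≤ 2 * M * kap * Real.sqrt |x| := by
  have h0 : Pk μ 0 y = 0 := by simp [Pk, igd_zero]
  simpa [h0] using Pk_diff h x 0 y

lemma cont_of_sqrt {X : Type*} [PseudoMetricSpace X] {f : ℝ → X} {C : ℝ}
    (h : ∀ x x', dist (f x) (f x') ≤ C * Real.sqrt |x - x'|) : Continuous f := by
  rw [continuous_iff_continuousAt]
  intro x
  rw [ContinuousAt, tendsto_iff_dist_tendsto_zero]
  refine squeeze_zero (fun _ => dist_nonneg) (fun x' => h x' x) ?_
  have : Continuous (fun x' : ℝ => C * Real.sqrt |x' - x|) := by fun_prop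
  simpa using this.tendsto x

lemma Pk_cont {μ : ℝ → ℂ} {M : ℝ} (h : Wt μ M) (x : ℝ) : Continuous (Pk μ x) := by
  refine cont_of_sqrt (C := 2 * M * kap) fun y y' => ?_
  rw [dist_eq_norm, Pk_symm μ x y, Pk_symm μ x y']
  have hfin := Pk_diff h y y' x
  exact hfin

/-- the Banach space of bounded continuous functions -/
abbrev EE := BoundedContinuousFunction ℝ ℂ

/-- the kernel as a continuous family of bounded continuous functions -/
def ker0 (μ : ℝ → ℂ) (M : ℝ) (h : Wt μ M) (x : ℝ) : EE :=
  BoundedContinuousFunction.ofNormedAddCommGroup (Pk μ x) (Pk_cont h x) _ (Pk_bound h x)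

lemma ker0_dist {μ : ℝ → ℂ} {M : ℝ} (h : Wt μ M) (x x' : ℝ) :
    dist (ker0 μ M h x) (ker0 μ M h x') ≤ (2 * M * kap) * Real.sqrt |x - x'| := by
  have : 0 ≤ (2 * M * kap) * Real.sqrt |x - x'| := by
    have := h.2.1; have := kap_nonneg; positivity
  rw [BoundedContinuousFunction.dist_le this]
  intro y
  rw [dist_eq_norm]
  exact Pk_diff h x x' y

open Classical in
/-- the kernel as a continuous family of bounded continuous functions -/
def kerE (μ : ℝ → ℂ) : C(ℝ, EE) :=
  if h : ∃ M, Wt μ M then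
    ⟨ker0 μ h.choose h.choose_spec, cont_of_sqrt (ker0_dist h.choose_spec)⟩
  else 0

lemma ker_apply {μ : ℝ → ℂ} {M : ℝ} (h : Wt μ M) (x y : ℝ) : kerE μ x y = Pk μ x y := by
  have h' : ∃ M, Wt μ M := ⟨M, h⟩
  unfold kerE
  rw [dif_pos h']
  rfl

lemma ker_norm {μ : ℝ → ℂ} {M : ℝ} (h : Wt μ M) (x : ℝ) :
    ‖kerE μ x‖ ≤ 2 * M * kap * Real.sqrt |x| := by
  have : 0 ≤ (2 * M * kap) * Real.sqrt |x| := by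
    have := h.2.1; have := kap_nonneg; positivity
  rw [BoundedContinuousFunction.norm_le this]
  intro y
  rw [ker_apply h]
  exact Pk_bound h x y

lemma wt_mw {w : ℂ} (hw : 0 < w.re) : Wt (mw w) (1 + ‖w‖) :=
  ⟨mw_cont hw, by positivity, fun _ hk => mw_bound hw hk⟩

lemma wt_mw1 {w : ℂ} (hw : 0 < w.re) : Wt (mw1 w) (1 + 1 / Real.sqrt w.re) :=
  ⟨mw1_cont hw, by positivity, fun _ hk => mw1_bound hw hk⟩

lemma wt_mw2 {w : ℂ} (hw : 0 < w.re) {w' : ℂ} (hw' : 0 < w'.re) :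
    Wt (mw2 w w') ((1 + 1 / Real.sqrt w.re) / w.re) :=
  ⟨mw2_cont hw hw', by positivity, fun _ hk => mw2_bound hw hw' hk⟩

lemma ker_taylor {w : ℂ} (hw : 0 < w.re) {w' : ℂ} (hw' : 0 < w'.re) (x : ℝ) :
    kerE (mw w') x - kerE (mw w) x - (w' - w) • kerE (mw1 w) x = (w' - w) ^ 2 • kerE (mw2 w w') x := by
  ext y
  have i1 := igd_int (wt_mw hw') x y
  have i2 := igd_int (wt_mw hw) x y
  have i3 := igd_int (wt_mw1 hw) x y
  simp only [BoundedContinuousFunction.coe_sub, BoundedContinuousFunction.coe_smul, Pi.sub_apply]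
  rw [ker_apply (wt_mw hw), ker_apply (wt_mw hw'), ker_apply (wt_mw1 hw),
    ker_apply (wt_mw2 hw hw'), smul_eq_mul, smul_eq_mul]
  unfold Pk
  rw [← integral_const_mul, ← integral_const_mul, ← integral_sub i1 i2,
    ← integral_sub (by exact i1.sub i2) (i3.const_mul _)]
  congr 1
  ext k
  have := mw_taylor hw hw' k
  unfold igd
  linear_combination ((Real.sin (k * x) / k : ℝ) : ℂ) * ((Real.sin (k * y) / k : ℝ) : ℂ) *
    ((2 * k / Real.pi : ℝ) : ℂ) * this

/-! ### Accretivity -/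

open ComplexConjugate in
lemma accretive {μ : ℝ → ℂ} {M : ℝ} (hμ : Wt μ M) (hre : ∀ k, 0 < k → 0 ≤ (μ k).re)
    (h : EE) {x : ℝ} :
    0 ≤ (∫ y in Ioc 0 x, (∫ s in Ioc 0 x, h s * Pk μ s y) * conj (h y)).re := by
  set S : ℝ → ℂ := fun k => ∫ s in Ioc 0 x, h s * ((Real.sin (k * s) : ℝ) : ℂ) with hS
  have hhn : ∀ s, ‖h s‖ ≤ ‖h‖ := fun s => h.norm_coe_le_norm s
  have hhc : Continuous h := h.continuous
  have hSc : Continuous S := by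
    refine continuous_of_dominated (bound := fun _ => ‖h‖) ?_ ?_ ?_ ?_
    · intro k
      exact (by fun_prop : Continuous (fun s => h s * ((Real.sin (k * s) : ℝ) : ℂ))).aestronglyMeasurable
    · intro k
      refine Eventually.of_forall fun s => ?_
      rw [norm_mul, Complex.norm_real, Real.norm_eq_abs]
      calc ‖h s‖ * |Real.sin (k * s)| ≤ ‖h‖ * 1 := by
            gcongr
            · exact hhn s
            · exact Real.abs_sin_le_one _
        _ = ‖h‖ := mul_one _
    · exact integrable_const _
    · exact Eventually.of_forall fun s => by fun_prop
  set c : ℝ → ℂ := fun k => μ k * ((2 / (Real.pi * k) : ℝ) : ℂ) with hc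
  have hcm : Measurable c := by
    have := hμ.1.measurable
    refine this.mul ?_
    fun_prop
  -- the integrand in factored form
  have hig : ∀ s y k : ℝ, 0 < k → igd μ s y k =
      ((Real.sin (k * s) : ℝ) : ℂ) * (((Real.sin (k * y) : ℝ) : ℂ) * c k) := by
    intro s y k hk
    have hk' : (k : ℂ) ≠ 0 := by exact_mod_cast hk.ne'
    have hpi : (Real.pi : ℂ) ≠ 0 := by exact_mod_cast Real.pi_ne_zero
    rw [hc]; unfold igd; push_cast; field_simp
  have hM := hμ.2.1
  have hbd : ∀ s ∈ Ioc 0 x, ∀ y k : ℝ, 0 < k →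
      ‖igd μ s y k‖ ≤ 2 * M * Real.sqrt |x| * kb k := by
    intro s hs y k hk
    refine (igd_bound hμ s y hk).trans ?_
    have := kb_nonneg hk
    gcongr
    · exact hs.1.le
    · exact hs.2
  have hprodae : ∀ᵐ p : ℝ × ℝ ∂((volume.restrict (Ioc 0 x)).prod (volume.restrict (Ioi 0))),
      p.1 ∈ Ioc 0 x ∧ 0 < p.2 := by
    rw [Measure.prod_restrict]
    exact (ae_restrict_iff' (measurableSet_Ioc.prod measurableSet_Ioi)).2
      (Eventually.of_forall fun p hp => hp)
  -- first swap
  have h1 : ∀ y, ∫ s in Ioc 0 x, h s * Pk μ s y =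
      ∫ k in Ioi (0:ℝ), S k * (((Real.sin (k * y) : ℝ) : ℂ) * c k) := by
    intro y
    have e1 : ∀ s, h s * Pk μ s y = ∫ k in Ioi (0:ℝ), h s * igd μ s y k := by
      intro s; unfold Pk; rw [integral_const_mul]
    simp_rw [e1]
    rw [integral_integral_swap]
    · refine setIntegral_congr_fun measurableSet_Ioi fun k hk => ?_
      beta_reduce
      rw [hS]
      beta_reduce
      rw [← integral_mul_const]
      congr 1
      ext s
      rw [hig s y k hk]; ring
    · refine Integrable.mono' (g := fun p : ℝ × ℝ => ‖h‖ * (2 * M * Real.sqrt |x| * kb p.2))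
        ?_ ?_ ?_
      · exact (integrable_const (‖h‖)).mul_prod (kb_int.const_mul (2 * M * Real.sqrt |x|))
      · refine Measurable.aestronglyMeasurable ?_
        refine Measurable.mul (hhc.measurable.comp measurable_fst) ?_
        exact igd_meas hμ y
      · filter_upwards [hprodae] with p hp
        rw [Function.uncurry, norm_mul]
        gcongr
        · exact hhn _
        · exact hbd _ hp.1 _ _ hp.2
  simp_rw [h1]
  -- second swap
  have h2 : ∫ y in Ioc 0 x, (∫ k in Ioi (0:ℝ), S k * (((Real.sin (k * y) : ℝ) : ℂ) * c k)) *
      conj (h y) = ∫ k in Ioi (0:ℝ), c k * (S k * conj (S k)) := by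
    simp_rw [← integral_mul_const]
    rw [integral_integral_swap]
    · refine setIntegral_congr_fun measurableSet_Ioi fun k hk => ?_
      beta_reduce
      have : conj (S k) = ∫ y in Ioc 0 x, ((Real.sin (k * y) : ℝ) : ℂ) * conj (h y) := by
        rw [hS]
        beta_reduce
        rw [← integral_conj]
        congr 1
        ext s
        rw [map_mul, Complex.conj_ofReal]; ring
      rw [this, ← mul_assoc, ← integral_const_mul]
      congr 1
      ext y
      ring
    · refine Integrable.mono'
        (g := fun p : ℝ × ℝ => ‖h‖ * ((‖h‖ * x) * (2 * M * Real.sqrt |x| * kb p.2))) ?_ ?_ ?_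
      · exact (integrable_const (‖h‖)).mul_prod
          ((kb_int.const_mul (2 * M * Real.sqrt |x|)).const_mul (‖h‖ * x))
      · refine Measurable.aestronglyMeasurable ?_
        have m1 := hSc.measurable
        have m2 := hhc.measurable
        refine Measurable.mul (Measurable.mul (m1.comp measurable_snd)
          (Measurable.mul ?_ (hcm.comp measurable_snd))) ?_
        · fun_prop
        · exact (Complex.continuous_conj.measurable.comp m2).comp measurable_fst
      · filter_upwards [hprodae] with p hp
        rw [Function.uncurry, norm_mul, RCLike.norm_conj, mul_comm]
        have hx : 0 ≤ x := hp.1.1.le.trans hp.1.2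
        gcongr
        · exact hhn _
        · have : S p.2 * (((Real.sin (p.2 * p.1) : ℝ) : ℂ) * c p.2) =
              ∫ s in Ioc 0 x, h s * igd μ s p.1 p.2 := by
            rw [hS]
            beta_reduce
            rw [← integral_mul_const]
            congr 1
            ext s
            rw [hig s p.1 p.2 hp.2]; ring
          rw [this]
          have hb := norm_setIntegral_le_of_norm_le_const (μ := volume) (s := Ioc 0 x)
            (f := fun s => h s * igd μ s p.1 p.2)
            (C := ‖h‖ * (2 * M * Real.sqrt |x| * kb p.2)) (by simp) (by
              intro s hs
              rw [norm_mul]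
              gcongr
              · exact hhn _
              · exact hbd s hs _ _ hp.2)
          refine hb.trans (le_of_eq ?_)
          rw [Real.volume_real_Ioc_of_le hx]
          ring
  rw [h2]
  by_cases hI : IntegrableOn (fun k => c k * (S k * conj (S k))) (Ioi 0)
  · have : (∫ k in Ioi (0:ℝ), c k * (S k * conj (S k))).re =
        ∫ k in Ioi (0:ℝ), (c k * (S k * conj (S k))).re := by
      exact (integral_re hI).symm
    rw [this]
    refine setIntegral_nonneg measurableSet_Ioi fun k hk => ?_
    rw [Complex.mul_conj, hc]
    beta_reduce
    rw [Complex.re_mul_ofReal, Complex.re_mul_ofReal]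
    have hk' : (0:ℝ) < k := hk
    have := hre k hk
    have := Complex.normSq_nonneg (S k)
    positivity
  · rw [integral_undef hI]; simp

/-! ### Decomposition of the kernel -/

lemma sin_div_bound (t : ℝ) {k : ℝ} (hk : 0 < k) : |Real.sin (k * t) / k| ≤ |t| := by
  rw [abs_div, abs_of_pos hk, div_le_iff₀ hk]
  refine (Real.abs_sin_le_abs).trans ?_
  rw [abs_mul, abs_of_pos hk, mul_comm]

lemma sinc_eq (t : ℝ) {k : ℝ} (hk : 0 < k) : t * Real.sinc (k * t) = Real.sin (k * t) / k := by
  by_cases ht : t = 0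
  · simp [ht]
  · rw [Real.sinc_of_ne_zero (by positivity)]
    field_simp

lemma inv_int : IntegrableOn (fun k : ℝ => (1 + k ^ 2)⁻¹) (Ioi 0) :=
  integrable_inv_one_add_sq.integrableOn

lemma sq_int (t : ℝ) : IntegrableOn (fun k : ℝ => Real.sin (k * t) ^ 2 / k ^ 2) (Ioi 0) := by
  refine Integrable.mono' (inv_int.const_mul (1 + t ^ 2)) ?_ ?_
  · exact (by fun_prop : Measurable (fun k : ℝ => Real.sin (k * t) ^ 2 / k ^ 2)).aestronglyMeasurable
  · refine (ae_restrict_iff' measurableSet_Ioi).2 (Eventually.of_forall fun k hk => ?_)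
    have hk : (0:ℝ) < k := hk
    rw [Real.norm_of_nonneg (by positivity), ← div_eq_mul_inv, le_div_iff₀ (by positivity)]
    have h1 : Real.sin (k * t) ^ 2 / k ^ 2 ≤ t ^ 2 := by
      rw [← div_pow]
      exact sq_le_sq.2 (sin_div_bound t hk)
    have h2 : Real.sin (k * t) ^ 2 / k ^ 2 * k ^ 2 ≤ 1 := by
      rw [div_mul_cancel₀ _ (by positivity)]
      exact Real.sin_sq_le_one _
    linarith

/-- auxiliary integral -/
def Jn (t : ℝ) : ℝ := ∫ k in Ioi (0:ℝ), Real.sin (k * t) ^ 2 / k ^ 2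

lemma Jn_pos {t : ℝ} (ht : 0 < t) : Jn t = t * Jn 1 := by
  have h := integral_comp_mul_left_Ioi (fun k : ℝ => Real.sin (k * 1) ^ 2 / k ^ 2) 0 ht
  rw [mul_zero] at h
  have e : ∫ x in Ioi (0:ℝ), Real.sin (t * x * 1) ^ 2 / (t * x) ^ 2 = (t ^ 2)⁻¹ * Jn t := by
    unfold Jn
    rw [← integral_const_mul]
    congr 1
    ext k
    rw [mul_one, mul_comm t k, mul_pow, div_mul_eq_div_div, div_eq_inv_mul _ (t^2)]
  rw [e] at h
  have h' : (t ^ 2)⁻¹ * Jn t = t⁻¹ * Jn 1 := h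
  field_simp at h'
  linarith

lemma Jn_abs (t : ℝ) : Jn t = |t| * Jn 1 := by
  rcases lt_trichotomy t 0 with h | h | h
  · have : Jn t = Jn (-t) := by
      unfold Jn; congr 1; ext k; simp
    rw [this, Jn_pos (by linarith), abs_of_neg h]
  · simp [h, Jn]
  · rw [Jn_pos h, abs_of_pos h]

lemma sin_sin_eq (x y k : ℝ) : Real.sin (k * x) * Real.sin (k * y) / k ^ 2 =
    Real.sin (k * ((x + y) / 2)) ^ 2 / k ^ 2 - Real.sin (k * ((x - y) / 2)) ^ 2 / k ^ 2 := by
  rw [← sub_div]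
  congr 1
  have e1 : k * x = k * ((x + y) / 2) + k * ((x - y) / 2) := by ring
  have e2 : k * y = k * ((x + y) / 2) - k * ((x - y) / 2) := by ring
  rw [e1, e2, Real.sin_add, Real.sin_sub]
  generalize k * ((x + y) / 2) = a
  generalize k * ((x - y) / 2) = b
  have ha := Real.sin_sq_add_cos_sq a
  have hb := Real.sin_sq_add_cos_sq b
  linear_combination (Real.sin a ^ 2) * hb - (Real.sin b ^ 2) * ha

lemma sin_sin_int (x y : ℝ) :
    IntegrableOn (fun k : ℝ => Real.sin (k * x) * Real.sin (k * y) / k ^ 2) (Ioi 0) := by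
  simp_rw [sin_sin_eq]
  exact (sq_int _).sub (sq_int _)

lemma sin_sin_integral {x y : ℝ} (hy : 0 ≤ y) (hyx : y ≤ x) :
    ∫ k in Ioi (0:ℝ), Real.sin (k * x) * Real.sin (k * y) / k ^ 2 = Jn 1 * y := by
  simp_rw [sin_sin_eq]
  rw [integral_sub (sq_int _) (sq_int _)]
  change Jn _ - Jn _ = _
  rw [Jn_abs, Jn_abs ((x - y) / 2), abs_of_nonneg (by linarith), abs_of_nonneg (by linarith)]
  ring

lemma rho_int {w : ℂ} (hw : 0 < w.re) : IntegrableOn (rho w) (Ioi 0) := by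
  refine Integrable.mono' (inv_int.const_mul ((1 + ‖w‖) ^ 2)) (rho_meas hw).aestronglyMeasurable ?_
  exact (ae_restrict_iff' measurableSet_Ioi).2 (Eventually.of_forall fun k hk => rho_bound hw hk)

/-- mass -/
def Bm : ℝ := ∫ k in Ioi (0:ℝ), (1 + k ^ 2)⁻¹

lemma Bm_nonneg : 0 ≤ Bm := setIntegral_nonneg measurableSet_Ioi fun k _ => by positivity

/-- regular part of the kernel -/
def Psi (w : ℂ) (x y : ℝ) : ℂ :=
  (x * y : ℝ) * ∫ k in Ioi (0:ℝ), ((Real.sinc (k * x) * Real.sinc (k * y) : ℝ) : ℂ) * rho w k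

/-- its derivative -/
def Psi1 (w : ℂ) (x y : ℝ) : ℂ :=
  (y : ℝ) * ∫ k in Ioi (0:ℝ), ((Real.cos (k * x) * Real.sinc (k * y) : ℝ) : ℂ) * rho w k

lemma trig_cont {w : ℂ} (hw : 0 < w.re) {f : ℝ × ℝ → ℝ → ℝ}
    (hf : Continuous fun q : (ℝ × ℝ) × ℝ => f q.1 q.2) (hb : ∀ p k, |f p k| ≤ 1) :
    Continuous fun p : ℝ × ℝ => ∫ k in Ioi (0:ℝ), ((f p k : ℝ) : ℂ) * rho w k := by
  refine continuous_of_dominated (bound := fun k => ‖rho w k‖) ?_ ?_ ?_ ?_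
  · intro p
    have : Continuous (f p) := hf.comp (by fun_prop : Continuous fun k : ℝ => (p, k))
    exact ((Complex.continuous_ofReal.comp this).measurable.mul (rho_meas hw)).aestronglyMeasurable
  · intro p
    refine Eventually.of_forall fun k => ?_
    rw [norm_mul, Complex.norm_real, Real.norm_eq_abs]
    exact mul_le_of_le_one_left (norm_nonneg _) (hb p k)
  · exact (rho_int hw).norm
  · refine Eventually.of_forall fun k => ?_
    have : Continuous (fun p => f p k) := hf.comp (by fun_prop : Continuous fun p : ℝ × ℝ => (p, k))
    exact (Complex.continuous_ofReal.comp this).mul continuous_const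

lemma sinc_cont : Continuous Real.sinc := Real.continuous_sinc

lemma Psi_cont {w : ℂ} (hw : 0 < w.re) : Continuous fun p : ℝ × ℝ => Psi w p.1 p.2 := by
  unfold Psi
  have hs := sinc_cont
  refine Continuous.mul (by fun_prop) ?_
  refine trig_cont hw (f := fun p k => Real.sinc (k * p.1) * Real.sinc (k * p.2)) (by fun_prop) ?_
  intro p k
  rw [abs_mul]
  exact mul_le_one₀ (Real.abs_sinc_le_one _) (abs_nonneg _) (Real.abs_sinc_le_one _)

lemma Psi1_cont {w : ℂ} (hw : 0 < w.re) : Continuous fun p : ℝ × ℝ => Psi1 w p.1 p.2 := by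
  unfold Psi1
  have hs := sinc_cont
  refine Continuous.mul (by fun_prop) ?_
  refine trig_cont hw (f := fun p k => Real.cos (k * p.1) * Real.sinc (k * p.2)) (by fun_prop) ?_
  intro p k
  rw [abs_mul]
  exact mul_le_one₀ (Real.abs_cos_le_one _) (abs_nonneg _) (Real.abs_sinc_le_one _)

lemma Psi1_bound {w : ℂ} (hw : 0 < w.re) (x y : ℝ) :
    ‖Psi1 w x y‖ ≤ |y| * ((1 + ‖w‖) ^ 2 * Bm) := by
  unfold Psi1
  rw [norm_mul, Complex.norm_real, Real.norm_eq_abs]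
  gcongr
  have : (1 + ‖w‖) ^ 2 * Bm = ∫ k in Ioi (0:ℝ), (1 + ‖w‖) ^ 2 * (1 + k ^ 2)⁻¹ := by
    rw [integral_const_mul]; rfl
  rw [this]
  refine norm_integral_le_of_norm_le (inv_int.const_mul _)
    ((ae_restrict_iff' measurableSet_Ioi).2 (Eventually.of_forall fun k hk => ?_))
  refine le_trans ?_ (rho_bound hw hk)
  rw [norm_mul, Complex.norm_real, Real.norm_eq_abs]
  refine mul_le_of_le_one_left (norm_nonneg _) ?_
  rw [abs_mul]
  exact mul_le_one₀ (Real.abs_cos_le_one _) (abs_nonneg _) (Real.abs_sinc_le_one _)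

lemma Psi_eq (w : ℂ) (x y : ℝ) : Psi w x y =
    ∫ k in Ioi (0:ℝ), ((Real.sin (k * x) / k * (Real.sin (k * y) / k) : ℝ) : ℂ) * rho w k := by
  unfold Psi
  rw [← integral_const_mul]
  refine setIntegral_congr_fun measurableSet_Ioi fun k hk => ?_
  beta_reduce
  rw [← sinc_eq x hk, ← sinc_eq y hk]
  push_cast; ring

lemma Psi1_eq (w : ℂ) (x y : ℝ) : Psi1 w x y =
    ∫ k in Ioi (0:ℝ), ((Real.cos (k * x) * (Real.sin (k * y) / k) : ℝ) : ℂ) * rho w k := by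
  unfold Psi1
  rw [← integral_const_mul]
  refine setIntegral_congr_fun measurableSet_Ioi fun k hk => ?_
  beta_reduce
  rw [← sinc_eq y hk]
  push_cast; ring

lemma Psi_symm (w : ℂ) (x y : ℝ) : Psi w x y = Psi w y x := by
  rw [Psi_eq, Psi_eq]
  congr 1; ext k; rw [mul_comm (Real.sin (k * x) / k)]

lemma trig_meas {w : ℂ} (hw : 0 < w.re) {f : ℝ → ℝ} (hf : Measurable f) :
    AEStronglyMeasurable (fun k => ((f k : ℝ) : ℂ) * rho w k) (volume.restrict (Ioi 0)) :=
  ((Complex.measurable_ofReal.comp hf).mul (rho_meas hw)).aestronglyMeasurable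

lemma trig_int {w : ℂ} (hw : 0 < w.re) {f : ℝ → ℝ} (hf : Measurable f) {C : ℝ}
    (hC : ∀ k, 0 < k → |f k| ≤ C) :
    IntegrableOn (fun k => ((f k : ℝ) : ℂ) * rho w k) (Ioi 0) := by
  refine Integrable.mono' ((rho_int hw).norm.const_mul C) (trig_meas hw hf) ?_
  refine (ae_restrict_iff' measurableSet_Ioi).2 (Eventually.of_forall fun k hk => ?_)
  rw [norm_mul, Complex.norm_real, Real.norm_eq_abs]
  gcongr
  exact hC k hk

lemma trig_deriv {w : ℂ} (hw : 0 < w.re) {f f' : ℝ → ℝ → ℝ} (hf : ∀ x, Measurable (f x))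
    (hf' : ∀ x, Measurable (f' x)) {C C' : ℝ} {x : ℝ}
    (hC : ∀ k, 0 < k → |f x k| ≤ C)
    (hC' : ∀ x' ∈ Metric.ball x 1, ∀ k, 0 < k → |f' x' k| ≤ C')
    (hd : ∀ x' k, 0 < k → HasDerivAt (fun t => f t k) (f' x' k) x') :
    HasDerivAt (fun t => ∫ k in Ioi (0:ℝ), ((f t k : ℝ) : ℂ) * rho w k)
      (∫ k in Ioi (0:ℝ), ((f' x k : ℝ) : ℂ) * rho w k) x := by
  refine (hasDerivAt_integral_of_dominated_loc_of_deriv_le (μ := volume.restrict (Ioi (0:ℝ)))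
    (F := fun t k => ((f t k : ℝ) : ℂ) * rho w k) (F' := fun t k => ((f' t k : ℝ) : ℂ) * rho w k)
    (bound := fun k => C' * ‖rho w k‖) (Metric.ball_mem_nhds x one_pos)
    (Eventually.of_forall fun t => trig_meas hw (hf t)) (trig_int hw (hf x) hC)
    (trig_meas hw (hf' x)) ?_ ((rho_int hw).norm.const_mul C') ?_).2
  · refine (ae_restrict_iff' measurableSet_Ioi).2 (Eventually.of_forall fun k hk t ht => ?_)
    rw [norm_mul, Complex.norm_real, Real.norm_eq_abs]
    gcongr
    exact hC' t ht k hk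
  · refine (ae_restrict_iff' measurableSet_Ioi).2 (Eventually.of_forall fun k hk t ht => ?_)
    exact ((hd t k hk).ofReal_comp).mul_const _

lemma sin_div_deriv (x : ℝ) {k : ℝ} (hk : 0 < k) :
    HasDerivAt (fun t => Real.sin (k * t) / k) (Real.cos (k * x)) x := by
  have h := (((hasDerivAt_id x).const_mul k).sin).div_const k
  have e : Real.cos (k * id x) * (k * 1) / k = Real.cos (k * x) := by
    rw [id, mul_one, mul_div_cancel_right₀ _ hk.ne']
  rw [e] at h
  exact h

lemma Psi_deriv {w : ℂ} (hw : 0 < w.re) (x y : ℝ) :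
    HasDerivAt (fun t => Psi w t y) (Psi1 w x y) x := by
  simp_rw [Psi_eq, Psi1_eq]
  refine trig_deriv hw (f := fun t k => Real.sin (k * t) / k * (Real.sin (k * y) / k))
    (f' := fun t k => Real.cos (k * t) * (Real.sin (k * y) / k)) (C := |x| * |y|) (C' := |y|)
    (by fun_prop) (by fun_prop) ?_ ?_ ?_
  · intro k hk
    rw [abs_mul]
    exact mul_le_mul (sin_div_bound x hk) (sin_div_bound y hk) (abs_nonneg _) (abs_nonneg _)
  · intro t _ k hk
    rw [abs_mul]
    exact (mul_le_of_le_one_left (abs_nonneg _) (Real.abs_cos_le_one _)).trans (sin_div_bound y hk)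
  · intro t k hk
    exact (sin_div_deriv t hk).mul_const _

lemma Psi_diag_deriv {w : ℂ} (hw : 0 < w.re) (x : ℝ) :
    HasDerivAt (fun t => Psi w t t) (2 * Psi1 w x x) x := by
  have e : 2 * Psi1 w x x =
    ∫ k in Ioi (0:ℝ), ((2 * (Real.cos (k * x) * (Real.sin (k * x) / k)) : ℝ) : ℂ) * rho w k := by
    rw [Psi1_eq, ← integral_const_mul]
    congr 1; ext k; push_cast; ring
  rw [e]
  simp_rw [Psi_eq]
  refine trig_deriv hw (f := fun t k => Real.sin (k * t) / k * (Real.sin (k * t) / k))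
    (f' := fun t k => 2 * (Real.cos (k * t) * (Real.sin (k * t) / k))) (C := |x| * |x|)
    (C' := 2 * (|x| + 1)) (by fun_prop) (by fun_prop) ?_ ?_ ?_
  · intro k hk
    rw [abs_mul]
    exact mul_le_mul (sin_div_bound x hk) (sin_div_bound x hk) (abs_nonneg _) (abs_nonneg _)
  · intro t ht k hk
    rw [abs_mul, abs_mul, abs_two]
    have h1 := (mul_le_of_le_one_left (abs_nonneg _) (Real.abs_cos_le_one (k * t))).trans
      (sin_div_bound t hk)
    rw [Metric.mem_ball, Real.dist_eq] at ht
    have h2 : |t| ≤ |t - x| + |x| := by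
      calc |t| = |(t - x) + x| := by ring_nf
        _ ≤ _ := abs_add_le _ _
    linarith
  · intro t k hk
    have h := (sin_div_deriv t hk).mul (sin_div_deriv t hk)
    have e : 2 * (Real.cos (k * t) * (Real.sin (k * t) / k)) = Real.cos (k * t) *
        (Real.sin (k * t) / k) + Real.sin (k * t) / k * Real.cos (k * t) := by ring
    rw [e]
    exact h

/-- the constant in front of the singular part -/
def ac (w : ℂ) : ℂ := w * ((Jn 1 / Real.pi : ℝ) : ℂ)

lemma Pk_decomp {w : ℂ} (hw : 0 < w.re) {x y : ℝ} (hy : 0 ≤ y) (hyx : y ≤ x) :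
    Pk (mw w) x y = ac w * y + Psi w x y := by
  have e1 : ac w * y = ∫ k in Ioi (0:ℝ), (w / Real.pi) *
      ((Real.sin (k * x) * Real.sin (k * y) / k ^ 2 : ℝ) : ℂ) := by
    rw [integral_const_mul]
    rw [integral_complex_ofReal, sin_sin_integral hy hyx]
    unfold ac; push_cast; ring
  have i1 : IntegrableOn (fun k : ℝ => (w / Real.pi) *
      ((Real.sin (k * x) * Real.sin (k * y) / k ^ 2 : ℝ) : ℂ)) (Ioi 0) :=
    ((sin_sin_int x y).ofReal).const_mul _
  have i2 : IntegrableOn (fun k : ℝ =>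
      ((Real.sin (k * x) / k * (Real.sin (k * y) / k) : ℝ) : ℂ) * rho w k) (Ioi 0) := by
    refine trig_int hw (f := fun k => Real.sin (k * x) / k * (Real.sin (k * y) / k))
      (by fun_prop) (C := |x| * |y|) ?_
    intro k hk
    rw [abs_mul]
    exact mul_le_mul (sin_div_bound x hk) (sin_div_bound y hk) (abs_nonneg _) (abs_nonneg _)
  rw [e1, Psi_eq, ← integral_add i1 i2]
  unfold Pk
  refine setIntegral_congr_fun measurableSet_Ioi fun k hk => ?_
  have h := rho_eq hw hk
  unfold igd
  beta_reduce
  have e2 : ((2 * k / Real.pi : ℝ) : ℂ) = 2 * k / Real.pi := by push_cast; rfl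
  rw [mul_assoc, e2, h]
  push_cast
  ring

/-! ### Operators -/

lemma hpsi_cont (ψ : C(ℝ, EE)) (h : EE) : Continuous fun s => h s • ψ s :=
  h.continuous.smul ψ.continuous

lemma hpsi_ii (ψ : C(ℝ, EE)) (h : EE) (a b : ℝ) :
    IntervalIntegrable (fun s => h s • ψ s) volume a b := (hpsi_cont ψ h).intervalIntegrable a b

lemma hpsi_bound (ψ : C(ℝ, EE)) (h : EE) (a b : ℝ) :
    ‖∫ s in a..b, h s • ψ s‖ ≤ |∫ s in a..b, ‖ψ s‖| * ‖h‖ := by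
  have h2 : |∫ s in a..b, ‖ψ s‖| * ‖h‖ = |∫ s in a..b, ‖h‖ * ‖ψ s‖| := by
    rw [intervalIntegral.integral_const_mul, abs_mul, abs_of_nonneg (norm_nonneg h), mul_comm]
  rw [h2]
  refine intervalIntegral.norm_integral_le_abs_of_norm_le ?_ ?_
  · refine Eventually.of_forall fun s => ?_
    rw [norm_smul]
    gcongr
    exact h.norm_coe_le_norm s
  · exact (continuous_const.mul (ψ.continuous.norm)).intervalIntegrable _ _

/-- the integral operator -/
def Jop (ψ : C(ℝ, EE)) (x : ℝ) : EE →L[ℂ] EE :=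
  LinearMap.mkContinuous
    { toFun := fun h => ∫ s in (0:ℝ)..x, h s • ψ s
      map_add' := fun h g => by
        rw [← intervalIntegral.integral_add (hpsi_ii ψ h 0 x) (hpsi_ii ψ g 0 x)]
        congr 1; ext s : 1
        simp [add_smul]
      map_smul' := fun c h => by
        rw [RingHom.id_apply, ← intervalIntegral.integral_smul]
        congr 1; ext s : 1
        simp [mul_smul] }
    |∫ s in (0:ℝ)..x, ‖ψ s‖| (fun h => hpsi_bound ψ h 0 x)

lemma Jop_apply (ψ : C(ℝ, EE)) (x : ℝ) (h : EE) : Jop ψ x h = ∫ s in (0:ℝ)..x, h s • ψ s := rfl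

lemma eval_integral {f : ℝ → EE} (hf : Continuous f) (a b y : ℝ) :
    (∫ s in a..b, f s) y = ∫ s in a..b, f s y :=
  ((BoundedContinuousFunction.evalCLM ℂ y).intervalIntegral_comp_comm
    (hf.intervalIntegrable a b)).symm

lemma Jop_eval (ψ : C(ℝ, EE)) (x : ℝ) (h : EE) (y : ℝ) :
    Jop ψ x h y = ∫ s in (0:ℝ)..x, h s * ψ s y := by
  rw [Jop_apply, eval_integral (hpsi_cont ψ h)]
  rfl

lemma Jop_norm (ψ : C(ℝ, EE)) (x : ℝ) {K : ℝ} (hK0 : 0 ≤ K)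
    (hK : ∀ s ∈ uIoc 0 x, ‖ψ s‖ ≤ K) : ‖Jop ψ x‖ ≤ K * |x| := by
  refine ContinuousLinearMap.opNorm_le_bound _ (by positivity) fun h => ?_
  rw [Jop_apply]
  have := intervalIntegral.norm_integral_le_of_norm_le_const (a := 0) (b := x)
    (f := fun s => h s • ψ s) (C := ‖h‖ * K) (fun s hs => by
      rw [norm_smul]
      gcongr
      · exact h.norm_coe_le_norm s
      · exact hK s hs)
  refine this.trans (le_of_eq ?_)
  rw [sub_zero]; ring

lemma Jop_cont (ψ : C(ℝ, EE)) : Continuous (Jop ψ) := by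
  rw [continuous_iff_continuousAt]
  intro x
  rw [ContinuousAt, tendsto_iff_norm_sub_tendsto_zero]
  refine squeeze_zero (fun _ => norm_nonneg _) (g := fun x' => |∫ s in x..x', ‖ψ s‖|) ?_ ?_
  · intro x'
    refine ContinuousLinearMap.opNorm_le_bound _ (abs_nonneg _) fun h => ?_
    rw [sub_apply, Jop_apply, Jop_apply,
      intervalIntegral.integral_interval_sub_left (hpsi_ii ψ h _ _) (hpsi_ii ψ h _ _)]
    exact hpsi_bound ψ h x x'
  · have : Continuous fun x' => |∫ s in x..x', ‖ψ s‖| := by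
      refine (intervalIntegral.continuous_primitive ?_ x).abs
      intro a b
      exact (ψ.continuous.norm).intervalIntegrable _ _
    simpa using this.tendsto x

lemma Jop_deriv (ψ : C(ℝ, EE)) (h : EE) (x : ℝ) :
    HasDerivAt (fun t => Jop ψ t h) (h x • ψ x) x := by
  simp_rw [Jop_apply]
  exact intervalIntegral.integral_hasDerivAt_right (hpsi_ii ψ h 0 x)
    ((hpsi_cont ψ h).stronglyMeasurableAtFilter _ _) (hpsi_cont ψ h).continuousAt

open ComplexConjugate in
/-- accretivity of the kernel -/
def Accr (ψ : C(ℝ, EE)) : Prop := ∀ (h : EE) (x : ℝ), 0 ≤ x →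
  0 ≤ (∫ y in (0:ℝ)..x, Jop ψ x h y * conj (h y)).re

open ComplexConjugate in
lemma apriori {ψ : C(ℝ, EE)} (ha : Accr ψ) {x : ℝ} (hx : 0 ≤ x) {K : ℝ} (hK0 : 0 ≤ K)
    (hK : ∀ s ∈ uIoc 0 x, ‖ψ s‖ ≤ K) {t : ℝ} (ht0 : 0 ≤ t) (ht1 : t ≤ 1) (h : EE) :
    ‖h‖ ≤ (1 + K * x) * ‖h + (t : ℂ) • Jop ψ x h‖ := by
  set f : EE := h + (t : ℂ) • Jop ψ x h with hf
  have hhc := h.continuous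
  have hfc := f.continuous
  have hJc := (Jop ψ x h).continuous
  set L : ℝ := ∫ y in (0:ℝ)..x, ‖h y‖ with hL
  have hL0 : 0 ≤ L := intervalIntegral.integral_nonneg hx fun _ _ => norm_nonneg _
  set I : ℝ := ∫ y in (0:ℝ)..x, ‖h y‖ ^ 2 with hI
  have hcc : Continuous fun y => conj (h y) := Complex.continuous_conj.comp hhc
  have e1 : ((I : ℝ) : ℂ) = (∫ y in (0:ℝ)..x, f y * conj (h y)) -
      t * ∫ y in (0:ℝ)..x, Jop ψ x h y * conj (h y) := by
    have c1 : Continuous fun y => f y * conj (h y) := hfc.mul hcc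
    have c2 : Continuous fun y => (t:ℂ) * (Jop ψ x h y * conj (h y)) :=
      continuous_const.mul (hJc.mul hcc)
    rw [hI, ← intervalIntegral.integral_ofReal, ← intervalIntegral.integral_const_mul,
      ← intervalIntegral.integral_sub (c1.intervalIntegrable _ _) (c2.intervalIntegrable _ _)]
    congr 1; ext y
    have : f y = h y + t * Jop ψ x h y := rfl
    rw [this]
    have h3 : ((‖h y‖ ^ 2 : ℝ) : ℂ) = h y * conj (h y) := by
      rw [Complex.mul_conj, Complex.normSq_eq_norm_sq]
    rw [h3]; ring
  have h1 : I ≤ ‖f‖ * L := by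
    have e2 := congrArg Complex.re e1
    rw [Complex.ofReal_re, Complex.sub_re, Complex.re_ofReal_mul] at e2
    have h2 := mul_nonneg ht0 (ha h x hx)
    have h3 : (∫ y in (0:ℝ)..x, f y * conj (h y)).re ≤ ‖f‖ * L := by
      refine (Complex.re_le_norm _).trans ?_
      rw [hL, ← intervalIntegral.integral_const_mul]
      refine intervalIntegral.norm_integral_le_of_norm_le hx ?_
        ((continuous_const.mul hhc.norm).intervalIntegrable _ _)
      refine Eventually.of_forall fun y _ => ?_
      rw [norm_mul, RCLike.norm_conj]
      gcongr
      exact f.norm_coe_le_norm y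
    linarith
  have h2 : ∀ c : ℝ, 2 * c * L ≤ I + c ^ 2 * x := by
    intro c
    have : I + c ^ 2 * x - 2 * c * L = ∫ y in (0:ℝ)..x, (‖h y‖ - c) ^ 2 := by
      have e : (fun y => (‖h y‖ - c) ^ 2) = fun y => (‖h y‖ ^ 2 - 2 * c * ‖h y‖) + c ^ 2 := by
        ext y; ring
      have c1 : Continuous fun y => ‖h y‖ ^ 2 := by fun_prop
      have c2 : Continuous fun y => 2 * c * ‖h y‖ := by fun_prop
      have c3 : Continuous fun y => ‖h y‖ ^ 2 - 2 * c * ‖h y‖ := by fun_prop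
      rw [e, intervalIntegral.integral_add (c3.intervalIntegrable _ _)
        (continuous_const.intervalIntegrable _ _),
        intervalIntegral.integral_sub (c1.intervalIntegrable _ _) (c2.intervalIntegrable _ _),
        intervalIntegral.integral_const_mul, intervalIntegral.integral_const, smul_eq_mul,
        sub_zero]
      ring
    have h3 : 0 ≤ ∫ y in (0:ℝ)..x, (‖h y‖ - c) ^ 2 :=
      intervalIntegral.integral_nonneg hx fun _ _ => sq_nonneg _
    linarith
  have h3 : L ≤ ‖f‖ * x := by
    by_cases hx0 : x = 0
    · rw [hL, hx0]; simp
    have hxp : 0 < x := lt_of_le_of_ne hx (Ne.symm hx0)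
    have h4 := h2 (L / x)
    have h5 : L ^ 2 ≤ ‖f‖ * x * L := by
      have h6 : 2 * (L / x) * L * x ≤ (I + (L / x) ^ 2 * x) * x := by gcongr
      have h7 : 2 * (L / x) * L * x = 2 * L ^ 2 := by field_simp
      have h8 : (I + (L / x) ^ 2 * x) * x = I * x + L ^ 2 := by field_simp
      nlinarith
    by_contra hcon
    push Not at hcon
    have : 0 < L := lt_of_le_of_lt (by positivity) hcon
    nlinarith
  rw [BoundedContinuousFunction.norm_le (by positivity)]
  intro y
  have e3 : h y = f y - t * Jop ψ x h y := by
    have : f y = h y + t * Jop ψ x h y := rfl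
    rw [this]; ring
  have h4 : ‖Jop ψ x h y‖ ≤ K * L := by
    rw [Jop_eval, hL, ← intervalIntegral.integral_const_mul]
    refine intervalIntegral.norm_integral_le_of_norm_le hx ?_
        ((continuous_const.mul hhc.norm).intervalIntegrable _ _)
    refine Eventually.of_forall fun s hs => ?_
    rw [norm_mul, mul_comm]
    gcongr
    refine ((ψ s).norm_coe_le_norm y).trans (hK s ?_)
    rwa [uIoc_of_le hx]
  calc ‖h y‖ ≤ ‖f y‖ + t * ‖Jop ψ x h y‖ := by
        rw [e3]
        refine (norm_sub_le _ _).trans ?_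
        rw [norm_mul, Complex.norm_real, Real.norm_of_nonneg ht0]
    _ ≤ ‖f‖ + 1 * (K * (‖f‖ * x)) := by
        gcongr
        · exact f.norm_coe_le_norm y
        · exact h4.trans (by gcongr)
    _ = _ := by ring

lemma inv_norm_le {E : Type*} [NormedAddCommGroup E] [NormedSpace ℂ E] {T : E →L[ℂ] E} {u : (E →L[ℂ] E)ˣ} (hu : (u : E →L[ℂ] E) = T) {C : ℝ}
    (hC : 0 ≤ C) (h : ∀ g : E, ‖g‖ ≤ C * ‖T g‖) : ‖((u⁻¹ : (E →L[ℂ] E)ˣ) : E →L[ℂ] E)‖ ≤ C := by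
  refine ContinuousLinearMap.opNorm_le_bound _ hC fun f => ?_
  refine (h _).trans (le_of_eq ?_)
  rw [← hu, ← mul_apply_eq_comp, Units.mul_inv, one_apply_eq_self]

lemma unit_step {E : Type*} [NormedAddCommGroup E] [NormedSpace ℂ E] [CompleteSpace E] {T : E →L[ℂ] E} {C : ℝ} (hC : 0 < C) (hT : IsUnit T)
    (h : ∀ g : E, ‖g‖ ≤ C * ‖T g‖) {S : E →L[ℂ] E} (hS : ‖S‖ * C < 1) : IsUnit (T + S) := by
  obtain ⟨u, hu⟩ := hT
  have h1 := inv_norm_le hu hC.le h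
  have h2 : ‖((u⁻¹ : (E →L[ℂ] E)ˣ) : E →L[ℂ] E) * S‖ < 1 := by
    refine lt_of_le_of_lt (norm_mul_le _ _) ?_
    rw [mul_comm]
    exact lt_of_le_of_lt (by gcongr) hS
  have h3 : IsUnit (1 + ((u⁻¹ : (E →L[ℂ] E)ˣ) : E →L[ℂ] E) * S) := by
    have := isUnit_one_sub_of_norm_lt_one (x := -(((u⁻¹ : (E →L[ℂ] E)ˣ) : E →L[ℂ] E) * S))
      (by rwa [norm_neg])
    rwa [sub_neg_eq_add] at this
  have h4 : T + S = u * (1 + ((u⁻¹ : (E →L[ℂ] E)ˣ) : E →L[ℂ] E) * S) := by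
    rw [mul_add, mul_one, ← mul_assoc, Units.mul_inv, one_mul, hu]
  rw [h4]
  exact u.isUnit.mul h3

lemma unit_cont {E : Type*} [NormedAddCommGroup E] [NormedSpace ℂ E] [CompleteSpace E] {T : E →L[ℂ] E} {C : ℝ} (hC : 0 < C)
    (h : ∀ t : ℝ, 0 ≤ t → t ≤ 1 → ∀ g : E, ‖g‖ ≤ C * ‖(1 + (t : ℂ) • T) g‖) :
    IsUnit (1 + T) := by
  obtain ⟨N, hN⟩ := exists_nat_gt (‖T‖ * C)
  have hN0 : (0:ℝ) < N := lt_of_le_of_lt (by positivity) hN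
  have key : ∀ n : ℕ, n ≤ N → IsUnit (1 + (((n / N : ℝ)) : ℂ) • T) := by
    intro n
    induction n with
    | zero => intro _; simp
    | succ n ih =>
      intro hn
      have h1 := ih (by omega)
      have hn' : (n : ℝ) ≤ N := by exact_mod_cast (by omega : n ≤ N)
      have h2 := unit_step hC h1 (h (n / N) (by positivity) ((div_le_one hN0).2 hn'))
        (S := ((1 / N : ℝ) : ℂ) • T) (by
          rw [norm_smul, Complex.norm_real, Real.norm_of_nonneg (by positivity), mul_assoc,
            one_div_mul_eq_div, div_lt_one hN0]
          exact hN)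
      rw [add_assoc, ← add_smul] at h2
      convert h2 using 4
      push_cast; ring
  have := key N le_rfl
  rw [div_self hN0.ne'] at this
  simpa using this

lemma unit_Jop {ψ : C(ℝ, EE)} (ha : Accr ψ) {x : ℝ} (hx : 0 ≤ x) {K : ℝ} (hK0 : 0 ≤ K)
    (hK : ∀ s ∈ uIoc 0 x, ‖ψ s‖ ≤ K) :
    IsUnit (1 + Jop ψ x) ∧ ‖Ring.inverse (1 + Jop ψ x)‖ ≤ 1 + K * x := by
  have hC : 0 < 1 + K * x := by positivity
  have h1 : IsUnit (1 + Jop ψ x) := unit_cont hC fun t ht0 ht1 g => apriori ha hx hK0 hK ht0 ht1 g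
  refine ⟨h1, ?_⟩
  obtain ⟨u, hu⟩ := h1
  rw [← hu, Ring.inverse_unit]
  refine inv_norm_le hu hC.le fun g => ?_
  have := apriori ha hx hK0 hK zero_le_one le_rfl g
  simpa using this

/-! ### Differentiation under the integral sign with moving endpoint -/

lemma leibniz {E : Type*} [NormedAddCommGroup E] [NormedSpace ℝ E] [CompleteSpace E]
    {U : Set ℝ} (hU : IsOpen U) {f f1 : ℝ → ℝ → E}
    (hf : ContinuousOn (fun p : ℝ × ℝ => f p.1 p.2) (U ×ˢ univ))
    (hf1 : ContinuousOn (fun p : ℝ × ℝ => f1 p.1 p.2) (U ×ˢ univ))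
    (hd : ∀ x ∈ U, ∀ s, HasDerivAt (fun t => f t s) (f1 x s) x) {x : ℝ} (hx : x ∈ U) :
    HasDerivAt (fun t => ∫ s in (0:ℝ)..t, f t s) (f x x + ∫ s in (0:ℝ)..x, f1 x s) x := by
  have hfs : ∀ t ∈ U, Continuous (f t) := by
    intro t ht
    rw [← continuousOn_univ]
    exact hf.comp (f := fun s : ℝ => (t, s)) (by fun_prop) (fun s _ => ⟨ht, mem_univ _⟩)
  have hf1s : ∀ t ∈ U, Continuous (f1 t) := by
    intro t ht
    rw [← continuousOn_univ]
    exact hf1.comp (f := fun s : ℝ => (t, s)) (by fun_prop) (fun s _ => ⟨ht, mem_univ _⟩)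
  obtain ⟨δ, hδ, hball⟩ := Metric.nhds_basis_closedBall.mem_iff.1 (hU.mem_nhds hx)
  -- fixed interval
  have h1 : HasDerivAt (fun t => ∫ s in (0:ℝ)..x, f t s) (∫ s in (0:ℝ)..x, f1 x s) x := by
    have hcomp : IsCompact (Metric.closedBall x δ ×ˢ uIcc 0 x) :=
      (isCompact_closedBall x δ).prod isCompact_uIcc
    obtain ⟨C, hC⟩ := hcomp.exists_bound_of_continuousOn
      (hf1.mono (prod_mono hball (subset_univ _)))
    refine (intervalIntegral.hasDerivAt_integral_of_dominated_loc_of_deriv_le (bound := fun _ => C)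
      (F' := f1) (s := Metric.closedBall x δ) (Metric.closedBall_mem_nhds x hδ) ?_
      ((hfs x hx).intervalIntegrable _ _)
      (hf1s x hx).aestronglyMeasurable ?_ (continuous_const.intervalIntegrable _ _) ?_).2
    · filter_upwards [hU.mem_nhds hx] with t ht using (hfs t ht).aestronglyMeasurable
    · refine Eventually.of_forall fun s hs t ht => ?_
      exact hC (t, s) ⟨ht, uIoc_subset_uIcc hs⟩
    · refine Eventually.of_forall fun s hs t ht => hd t (hball ht) s
  have h2 : HasDerivAt (fun t => ∫ s in x..t, f t s) (f x x) x := by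
    rw [hasDerivAt_iff_isLittleO, Asymptotics.isLittleO_iff]
    intro c hc
    have hcont : ContinuousAt (fun p : ℝ × ℝ => f p.1 p.2) (x, x) :=
      hf.continuousAt ((hU.prod isOpen_univ).mem_nhds ⟨hx, mem_univ _⟩)
    obtain ⟨ε, hε, hb⟩ := Metric.continuousAt_iff.1 hcont c hc
    filter_upwards [hU.mem_nhds hx, Metric.ball_mem_nhds x hε] with t ht htb
    rw [intervalIntegral.integral_same, sub_zero, ← intervalIntegral.integral_const,
      ← intervalIntegral.integral_sub ((hfs t ht).intervalIntegrable _ _)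
        (continuous_const.intervalIntegrable _ _)]
    rw [Real.norm_eq_abs]
    refine intervalIntegral.norm_integral_le_of_norm_le_const fun s hs => ?_
    have := @hb (t, s) ?_
    · rw [dist_eq_norm] at this
      exact this.le
    · rw [Prod.dist_eq]
      refine max_lt htb ?_
      refine lt_of_le_of_lt ?_ htb
      show dist s x ≤ dist t x
      rw [Real.dist_eq, Real.dist_eq]
      exact abs_sub_left_of_mem_uIcc (uIoc_subset_uIcc hs)
  have h3 := h2.add h1
  refine h3.congr_of_eventuallyEq ?_
  filter_upwards [hU.mem_nhds hx] with t ht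
  simp only [Pi.add_apply]
  rw [add_comm, intervalIntegral.integral_add_adjacent_intervals
    ((hfs t ht).intervalIntegrable _ _) ((hfs t ht).intervalIntegrable _ _)]

/-! ### The solution for fixed w -/

/-- kernel family -/
abbrev psi (w : ℂ) : C(ℝ, EE) := kerE (mw w)

lemma psi_apply {w : ℂ} (hw : 0 < w.re) (x y : ℝ) : psi w x y = Phi x y w :=
  ker_apply (wt_mw hw) x y

lemma Phi_symm (x y : ℝ) (w : ℂ) : Phi x y w = Phi y x w := Pk_symm _ _ _

lemma psi_accr {w : ℂ} (hw : 0 < w.re) : Accr (psi w) := by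
  intro h x hx
  have := accretive (wt_mw hw) (fun k _ => mw_re hw k) h (x := x)
  rw [intervalIntegral.integral_of_le hx]
  simp_rw [Jop_eval, intervalIntegral.integral_of_le hx, ker_apply (wt_mw hw)]
  exact this

/-- smooth branch of the kernel -/
def Gf (w : ℂ) (x s : ℝ) : ℂ := ac w * s + Psi w x s

lemma Gf_eq {w : ℂ} (hw : 0 < w.re) {x y : ℝ} (hy : 0 ≤ y) (hyx : y ≤ x) :
    Phi x y w = Gf w x y := Pk_decomp hw hy hyx

lemma Gf_cont {w : ℂ} (hw : 0 < w.re) : Continuous fun p : ℝ × ℝ => Gf w p.1 p.2 := by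
  unfold Gf
  have := Psi_cont hw
  fun_prop

lemma Gf_deriv {w : ℂ} (hw : 0 < w.re) (x s : ℝ) :
    HasDerivAt (fun t => Gf w t s) (Psi1 w x s) x := by
  unfold Gf
  exact (Psi_deriv hw x s).const_add _

/-- right-hand side -/
def Rv (w : ℂ) (x : ℝ) : EE := ∫ s in (0:ℝ)..x, Gf w x s • psi w s

/-- its derivative -/
def Rv1 (w : ℂ) (x : ℝ) : EE := Gf w x x • psi w x + ∫ s in (0:ℝ)..x, Psi1 w x s • psi w s

lemma Rv_deriv {w : ℂ} (hw : 0 < w.re) (x : ℝ) : HasDerivAt (Rv w) (Rv1 w x) x := by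
  have h1 := Gf_cont hw
  have h2 := Psi1_cont hw
  have h3 := (psi w).continuous
  refine leibniz (U := univ) isOpen_univ (f := fun x s => Gf w x s • psi w s)
    (f1 := fun x s => Psi1 w x s • psi w s) ?_ ?_ ?_ (mem_univ x)
  · exact (h1.smul (h3.comp continuous_snd)).continuousOn
  · exact (h2.smul (h3.comp continuous_snd)).continuousOn
  · intro x _ s
    exact (Gf_deriv hw x s).smul_const _

lemma Rv1_cont {w : ℂ} (hw : 0 < w.re) : Continuous (Rv1 w) := by
  have h1 := Gf_cont hw
  have h2 := Psi1_cont hw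
  have h3 := (psi w).continuous
  have h4 : Continuous fun p : ℝ × ℝ => Psi1 w p.1 p.2 • psi w p.2 := h2.smul (h3.comp continuous_snd)
  refine Continuous.add ?_ ?_
  · exact (h1.comp (continuous_id.prodMk continuous_id)).smul h3
  · exact intervalIntegral.continuous_parametric_intervalIntegral_of_continuous
      (f := fun x s => Psi1 w x s • psi w s) h4 continuous_id

lemma Rv_eq {w : ℂ} (hw : 0 < w.re) {x : ℝ} (hx : 0 ≤ x) : Rv w x = Jop (psi w) x (psi w x) := by
  rw [Jop_apply]
  refine intervalIntegral.integral_congr fun s hs => ?_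
  rw [uIcc_of_le hx] at hs
  change _ = psi w x s • psi w s
  rw [psi_apply hw, Gf_eq hw hs.1 hs.2]

/-- good set -/
def UU (w : ℂ) : Set ℝ := {x | IsUnit (1 + Jop (psi w) x)}

lemma isOpen_units {E : Type*} [NormedAddCommGroup E] [NormedSpace ℂ E] [CompleteSpace E] :
    IsOpen {T : E →L[ℂ] E | IsUnit T} := Units.isOpen

lemma inv_cont {E : Type*} [NormedAddCommGroup E] [NormedSpace ℂ E] [CompleteSpace E]
    {T : E →L[ℂ] E} (hT : IsUnit T) : ContinuousAt (fun S : E →L[ℂ] E => Ring.inverse S) T := by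
  obtain ⟨u, hu⟩ := hT
  have h1 := NormedRing.inverse_continuousAt u
  rwa [hu] at h1

lemma opc (w : ℂ) : Continuous fun t => 1 + Jop (psi w) t := continuous_const.add (Jop_cont (psi w))

lemma UU_open (w : ℂ) : IsOpen (UU w) :=
  isOpen_units.preimage (opc w)

lemma psi_norm_le {w : ℂ} (hw : 0 < w.re) {x X : ℝ} (hx : 0 ≤ x) (hX : x ≤ X) :
    ‖psi w x‖ ≤ 2 * (1 + ‖w‖) * kap * Real.sqrt X := by
  refine (ker_norm (wt_mw hw) x).trans ?_
  have := kap_nonneg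
  gcongr
  rwa [abs_of_nonneg hx]

/-- inverse operator -/
def Vv (w : ℂ) (x : ℝ) : EE →L[ℂ] EE := Ring.inverse (1 + Jop (psi w) x)

lemma Vv_main {w : ℂ} (hw : 0 < w.re) {x X : ℝ} (hx : 0 ≤ x) (hX : x ≤ X) :
    x ∈ UU w ∧ ‖Vv w x‖ ≤ 1 + 2 * (1 + ‖w‖) * kap * Real.sqrt X * X := by
  have hk := kap_nonneg
  have h := unit_Jop (psi_accr hw) hx (K := 2 * (1 + ‖w‖) * kap * Real.sqrt X) (by positivity)
    (fun s hs => by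
      rw [uIoc_of_le hx] at hs
      exact psi_norm_le hw hs.1.le (hs.2.trans hX))
  refine ⟨h.1, h.2.trans ?_⟩
  gcongr

lemma UU_mem {w : ℂ} (hw : 0 < w.re) {x : ℝ} (hx : 0 ≤ x) : x ∈ UU w := (Vv_main hw hx le_rfl).1

lemma Vv_cont (w : ℂ) : ContinuousOn (Vv w) (UU w) := by
  intro x hx
  exact (ContinuousAt.comp (f := fun t => 1 + Jop (psi w) t) (inv_cont hx)
    (opc w).continuousAt).continuousWithinAt

lemma Vv_left {w : ℂ} {x : ℝ} (hx : x ∈ UU w) (g : EE) :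
    Vv w x (g + Jop (psi w) x g) = g := by
  have h := Ring.inverse_mul_cancel _ hx
  have h2 := congrArg (fun T : EE →L[ℂ] EE => T g) h
  exact h2

lemma Vv_right {w : ℂ} {x : ℝ} (hx : x ∈ UU w) (g : EE) :
    Vv w x g + Jop (psi w) x (Vv w x g) = g := by
  have h := Ring.mul_inverse_cancel _ hx
  have h2 := congrArg (fun T : EE →L[ℂ] EE => T g) h
  exact h2

/-- regular part of the solution -/
def Dv (w : ℂ) (x : ℝ) : EE := Vv w x (Rv w x)

/-- its derivative -/
def Dv1 (w : ℂ) (x : ℝ) : EE := Vv w x (Rv1 w x - (Dv w x x) • psi w x)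

lemma Dv_deriv {w : ℂ} (hw : 0 < w.re) {x : ℝ} (hx : x ∈ UU w) :
    HasDerivAt (Dv w) (Dv1 w x) x := by
  have h1 : HasDerivAt (fun t => Rv w t - Jop (psi w) t (Dv w x)) (Rv1 w x - (Dv w x x) • psi w x) x :=
    (Rv_deriv hw x).sub (Jop_deriv (psi w) (Dv w x) x)
  rw [hasDerivAt_iff_tendsto_slope] at h1 ⊢
  have h2 : Tendsto (Vv w) (nhdsWithin x {x}ᶜ) (nhds (Vv w x)) :=
    ((Vv_cont w).continuousAt ((UU_open w).mem_nhds hx)).tendsto.mono_left nhdsWithin_le_nhds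
  have h3 : Tendsto (fun t => Vv w t (slope (fun t => Rv w t - Jop (psi w) t (Dv w x)) x t))
      (nhdsWithin x {x}ᶜ) (nhds (Dv1 w x)) := by
    have hc : Continuous fun q : (EE →L[ℂ] EE) × EE => q.1 q.2 := by fun_prop
    exact (hc.tendsto _).comp (h2.prodMk_nhds h1)
  refine h3.congr' ?_
  have h4 : ∀ᶠ t in nhdsWithin x {x}ᶜ, t ∈ UU w :=
    nhdsWithin_le_nhds ((UU_open w).mem_nhds hx)
  filter_upwards [h4] with t ht
  rw [slope_def_module, slope_def_module, ← Complex.coe_smul, ← Complex.coe_smul, map_smul]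
  congr 1
  have e1 : Rv w x - Jop (psi w) x (Dv w x) = Dv w x := by
    have := Vv_right hx (Rv w x)
    rw [sub_eq_iff_eq_add]; exact this.symm
  rw [e1]
  have e2 : Rv w t - Jop (psi w) t (Dv w x) - Dv w x =
      Rv w t - (Dv w x + Jop (psi w) t (Dv w x)) := by abel
  rw [e2, map_sub, Vv_left ht]
  rfl

lemma Dv_cont {w : ℂ} (hw : 0 < w.re) : ContinuousOn (Dv w) (UU w) :=
  fun _ hx => (Dv_deriv hw hx).continuousAt.continuousWithinAt

lemma eval_cont {f : ℝ → EE} {U : Set ℝ} (hf : ContinuousOn f U) :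
    ContinuousOn (fun p : ℝ × ℝ => f p.1 p.2) (U ×ˢ univ) := by
  have h1 : Continuous fun q : EE × ℝ => q.1 q.2 := continuous_eval
  exact h1.comp_continuousOn ((hf.comp continuousOn_fst fun p hp => hp.1).prodMk continuousOn_snd)

lemma diag_cont {f : ℝ → EE} {U : Set ℝ} (hf : ContinuousOn f U) :
    ContinuousOn (fun x : ℝ => f x x) U :=
  (eval_cont hf).comp (f := fun x : ℝ => (x, x)) (by fun_prop) (fun x hx => ⟨hx, mem_univ _⟩)

lemma Dv1_cont {w : ℂ} (hw : 0 < w.re) : ContinuousOn (Dv1 w) (UU w) := by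
  unfold Dv1
  refine (Vv_cont w).clm_apply ((Rv1_cont hw).continuousOn.sub ?_)
  exact (diag_cont (Dv_cont hw)).smul (psi w).continuous.continuousOn

/-! ### The solution -/

/-- the solution -/
def Av (x y : ℝ) (w : ℂ) : ℂ := Dv w x y - Phi x y w

/-- its derivative in the first variable -/
def Axv (x y : ℝ) (w : ℂ) : ℂ := Dv1 w x y - Psi1 w x y

lemma Dv_fix {w : ℂ} (hw : 0 < w.re) {x : ℝ} (hx : 0 ≤ x) :
    Dv w x = Jop (psi w) x (psi w x - Dv w x) := by
  have h := Vv_right (UU_mem hw hx) (Rv w x)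
  rw [map_sub, ← Rv_eq hw hx]
  exact eq_sub_of_add_eq h

lemma Dv_eq {w : ℂ} (hw : 0 < w.re) {x : ℝ} (hx : 0 ≤ x) :
    Dv w x = psi w x - Vv w x (psi w x) := by
  have h := Vv_left (UU_mem hw hx) (psi w x)
  rw [map_add, ← Rv_eq hw hx] at h
  exact eq_sub_of_add_eq' h

lemma Av_eq {w : ℂ} (hw : 0 < w.re) {x : ℝ} (hx : 0 ≤ x) (y : ℝ) :
    Av x y w = - (Vv w x (psi w x)) y := by
  unfold Av
  rw [Dv_eq hw hx, ← psi_apply hw]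
  simp

lemma Av_equation {w : ℂ} (hw : 0 < w.re) {x : ℝ} (hx : 0 ≤ x) (y : ℝ) :
    Av x y w + (∫ s in (0:ℝ)..x, Av x s w * Phi s y w) + Phi x y w = 0 := by
  have h := Vv_right (UU_mem hw hx) (psi w x)
  have h2 := congrArg (fun g : EE => g y) h
  simp only [BoundedContinuousFunction.coe_add, Pi.add_apply] at h2
  rw [Jop_eval] at h2
  simp_rw [psi_apply hw] at h2
  simp_rw [Av_eq hw hx, neg_mul, intervalIntegral.integral_neg]
  rw [← h2]; ring

lemma Phi_cont {w : ℂ} (hw : 0 < w.re) : Continuous fun p : ℝ × ℝ => Phi p.1 p.2 w := by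
  have h := eval_cont (f := psi w) (U := univ) (psi w).continuous.continuousOn
  rw [univ_prod_univ, continuousOn_univ] at h
  simpa only [psi_apply hw] using h

lemma Av_cont {w : ℂ} (hw : 0 < w.re) :
    ContinuousOn (fun p : ℝ × ℝ => Av p.1 p.2 w) (UU w ×ˢ univ) :=
  (eval_cont (Dv_cont hw)).sub (Phi_cont hw).continuousOn

lemma Axv_cont {w : ℂ} (hw : 0 < w.re) :
    ContinuousOn (fun p : ℝ × ℝ => Axv p.1 p.2 w) (UU w ×ˢ univ) :=
  (eval_cont (Dv1_cont hw)).sub (Psi1_cont hw).continuousOn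

lemma Phi_min {w : ℂ} (hw : 0 < w.re) {x y : ℝ} (hx : 0 ≤ x) (hy : 0 ≤ y) :
    Phi x y w = ac w * (min x y : ℝ) + Psi w x y := by
  rcases le_total y x with h | h
  · rw [min_eq_right h]; exact Gf_eq hw hy h
  · rw [min_eq_left h, Phi_symm, Psi_symm]; exact Gf_eq hw hx h

lemma Phi_lip {w : ℂ} (hw : 0 < w.re) {x x' y : ℝ} (hx : 0 ≤ x) (hx' : 0 ≤ x') (hy : 0 ≤ y) :
    ‖Phi x' y w - Phi x y w‖ ≤ (‖ac w‖ + y * ((1 + ‖w‖) ^ 2 * Bm)) * |x' - x| := by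
  rw [Phi_min hw hx hy, Phi_min hw hx' hy]
  have e : ac w * ((min x' y : ℝ) : ℂ) + Psi w x' y - (ac w * ((min x y : ℝ) : ℂ) + Psi w x y) =
      ac w * ((min x' y - min x y : ℝ) : ℂ) + (Psi w x' y - Psi w x y) := by push_cast; ring
  rw [e, add_mul]
  refine (norm_add_le _ _).trans (add_le_add ?_ ?_)
  · rw [norm_mul, Complex.norm_real, Real.norm_eq_abs]
    refine mul_le_mul_of_nonneg_left ?_ (norm_nonneg _)
    refine (abs_min_sub_min_le_max x' y x y).trans (le_of_eq ?_)
    simp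
  · have := Convex.norm_image_sub_le_of_norm_hasDerivWithin_le (s := univ) (f := fun t => Psi w t y)
      (f' := fun t => Psi1 w t y) (C := y * ((1 + ‖w‖) ^ 2 * Bm)) (x := x) (y := x')
      (fun t _ => (Psi_deriv hw t y).hasDerivWithinAt)
      (fun t _ => by simpa [abs_of_nonneg hy] using Psi1_bound hw t y) convex_univ
      (mem_univ _) (mem_univ _)
    simpa [Real.norm_eq_abs] using this

lemma Phi_quot {w : ℂ} (hw : 0 < w.re) {x y : ℝ} (hy : 0 ≤ y) (hyx : y < x) :
    HasDerivAt (fun t => Phi t y w) (Psi1 w x y) x := by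
  refine (Gf_deriv hw x y).congr_of_eventuallyEq ?_
  filter_upwards [lt_mem_nhds hyx] with t ht
  exact Gf_eq hw hy ht.le

lemma eval_deriv {f : ℝ → EE} {f' : EE} {x : ℝ} (h : HasDerivAt f f' x) (y : ℝ) :
    HasDerivAt (fun t => f t y) (f' y) x := by
  let T : EE →L[ℝ] ℂ := (BoundedContinuousFunction.evalCLM ℂ y : EE →L[ℂ] ℂ).restrictScalars ℝ
  exact T.hasFDerivAt.comp_hasDerivAt x h

lemma Av_L2 {w : ℂ} (hw : 0 < w.re) {x₀ : ℝ} (hx : 0 < x₀) :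
    Tendsto (fun h : ℝ => ∫ y in Ioc (0:ℝ) x₀,
        ‖(Av (x₀ + h) y w - Av x₀ y w) / (h : ℂ) - Axv x₀ y w‖ ^ 2)
      (nhdsWithin 0 {0}ᶜ) (nhds 0) := by
  have hU := UU_mem hw hx.le
  have hD := Dv_deriv hw hU
  have hmeasA : ∀ x, Continuous fun y => Av x y w := fun x =>
    (Dv w x).continuous.sub (Pk_cont (wt_mw hw) x)
  have hmeasAx : Continuous fun y => Axv x₀ y w := by
    have := Psi1_cont hw
    exact (Dv1 w x₀).continuous.sub (by fun_prop)
  have hB := Bm_nonneg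
  -- bound for the quotients of the regular part
  have hb : ∀ᶠ h in nhdsWithin (0:ℝ) {0}ᶜ,
      ‖Dv w (x₀ + h) - Dv w x₀‖ ≤ (‖Dv1 w x₀‖ + 1) * |h| := by
    have h1 := hasDerivAt_iff_tendsto_slope_zero.1 hD
    have h2 := h1.norm.eventually (gt_mem_nhds (lt_add_one ‖Dv1 w x₀‖))
    filter_upwards [h2, self_mem_nhdsWithin] with h hh hne
    have hp : 0 < |h| := abs_pos.2 hne
    rw [norm_smul, norm_inv, Real.norm_eq_abs, inv_mul_eq_div, div_lt_iff₀ hp] at hh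
    exact hh.le
  have hpos : ∀ᶠ h in nhdsWithin (0:ℝ) {0}ᶜ, 0 ≤ x₀ + h := by
    refine nhdsWithin_le_nhds ?_
    filter_upwards [lt_mem_nhds (show -x₀ < 0 by linarith)] with h hh
    linarith
  set M : ℝ := (‖Dv1 w x₀‖ + 1) + (‖ac w‖ + x₀ * ((1 + ‖w‖) ^ 2 * Bm)) +
    (‖Dv1 w x₀‖ + x₀ * ((1 + ‖w‖) ^ 2 * Bm)) with hM
  have := tendsto_integral_filter_of_dominated_convergence (μ := volume.restrict (Ioc 0 x₀))
    (F := fun (h y : ℝ) => ‖(Av (x₀ + h) y w - Av x₀ y w) / (h : ℂ) - Axv x₀ y w‖ ^ 2)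
    (f := fun _ => (0:ℝ)) (l := nhdsWithin (0:ℝ) {0}ᶜ) (bound := fun _ => M ^ 2) ?_ ?_ ?_ ?_
  · simpa using this
  · refine Eventually.of_forall fun h => ?_
    have h1 := hmeasA (x₀ + h)
    have h2 := hmeasA x₀
    exact (((h1.sub h2).div_const _).sub hmeasAx).norm.pow 2 |>.aestronglyMeasurable
  · filter_upwards [hb, hpos, self_mem_nhdsWithin] with h hh hp hne
    refine (ae_restrict_iff' measurableSet_Ioc).2 (Eventually.of_forall fun y hy => ?_)
    have hp : 0 < |h| := abs_pos.2 hne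
    rw [Real.norm_of_nonneg (by positivity)]
    gcongr
    have hxq : x₀ * ((1 + ‖w‖) ^ 2 * Bm) ≥ y * ((1 + ‖w‖) ^ 2 * Bm) := by
      have := hy.2; gcongr
    refine (norm_sub_le _ _).trans (add_le_add ?_ ?_)
    · rw [norm_div, Complex.norm_real, Real.norm_eq_abs, div_le_iff₀ hp, add_mul]
      have e : Av (x₀ + h) y w - Av x₀ y w = (Dv w (x₀ + h) - Dv w x₀) y -
          (Phi (x₀ + h) y w - Phi x₀ y w) := by
        simp [Av]; ring
      rw [e]
      refine (norm_sub_le _ _).trans (add_le_add ?_ ?_)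
      · exact ((Dv w (x₀ + h) - Dv w x₀).norm_coe_le_norm y).trans hh
      · refine (Phi_lip hw hx.le (by assumption) hy.1.le).trans ?_
        rw [add_sub_cancel_left]
        gcongr
    · refine (norm_sub_le _ _).trans (add_le_add ((Dv1 w x₀).norm_coe_le_norm y) ?_)
      refine (Psi1_bound hw x₀ y).trans ?_
      rw [abs_of_pos hy.1]
      exact hxq
  · exact integrable_const _
  · have hne : ∀ᵐ y ∂(volume : Measure ℝ), y ≠ x₀ := by
      simp [ae_iff, measure_singleton]
    refine (ae_restrict_iff' measurableSet_Ioc).2 ?_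
    filter_upwards [hne] with y hyne hy
    have hlt : y < x₀ := lt_of_le_of_ne hy.2 hyne
    have h1 : HasDerivAt (fun t => Av t y w) (Axv x₀ y w) x₀ :=
      (eval_deriv hD y).sub (Phi_quot hw hy.1.le hlt)
    have h2 := hasDerivAt_iff_tendsto_slope_zero.1 h1
    have h3 := ((h2.sub_const (Axv x₀ y w)).norm.pow 2)
    rw [sub_self, norm_zero, zero_pow two_ne_zero] at h3
    refine h3.congr fun h => ?_
    rw [← Complex.coe_smul, smul_eq_mul, Complex.ofReal_inv, inv_mul_eq_div]

lemma Axv_L2 {w : ℂ} (hw : 0 < w.re) {x₀ : ℝ} (hx : 0 < x₀) :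
    Tendsto (fun x' : ℝ => ∫ y in Ioc (0:ℝ) x₀, ‖Axv x' y w - Axv x₀ y w‖ ^ 2)
      (nhds x₀) (nhds 0) := by
  have hU := UU_mem hw hx.le
  have hUn := (UU_open w).mem_nhds hU
  have hmeasAx : ∀ x, Continuous fun y => Axv x y w := by
    intro x
    have := Psi1_cont hw
    exact (Dv1 w x).continuous.sub (by fun_prop)
  have hB := Bm_nonneg
  have hb : ∀ᶠ x in nhds x₀, ‖Dv1 w x‖ < ‖Dv1 w x₀‖ + 1 :=
    ((Dv1_cont hw).continuousAt hUn).norm.eventually (gt_mem_nhds (lt_add_one ‖Dv1 w x₀‖))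
  set M : ℝ := ((‖Dv1 w x₀‖ + 1) + x₀ * ((1 + ‖w‖) ^ 2 * Bm)) +
    ((‖Dv1 w x₀‖ + 1) + x₀ * ((1 + ‖w‖) ^ 2 * Bm)) with hM
  have := tendsto_integral_filter_of_dominated_convergence (μ := volume.restrict (Ioc 0 x₀))
    (F := fun (x' y : ℝ) => ‖Axv x' y w - Axv x₀ y w‖ ^ 2)
    (f := fun _ => (0:ℝ)) (l := nhds x₀) (bound := fun _ => M ^ 2) ?_ ?_ ?_ ?_
  · simpa using this
  · refine Eventually.of_forall fun x => ?_
    exact ((hmeasAx x).sub (hmeasAx x₀)).norm.pow 2 |>.aestronglyMeasurable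
  · filter_upwards [hb] with x hxb
    refine (ae_restrict_iff' measurableSet_Ioc).2 (Eventually.of_forall fun y hy => ?_)
    rw [Real.norm_of_nonneg (by positivity)]
    gcongr
    have key : ∀ x, ‖Dv1 w x‖ < ‖Dv1 w x₀‖ + 1 →
        ‖Axv x y w‖ ≤ (‖Dv1 w x₀‖ + 1) + x₀ * ((1 + ‖w‖) ^ 2 * Bm) := by
      intro x hx
      refine (norm_sub_le _ _).trans (add_le_add (((Dv1 w x).norm_coe_le_norm y).trans hx.le) ?_)
      refine (Psi1_bound hw x y).trans ?_
      rw [abs_of_pos hy.1]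
      have := hy.2
      gcongr
    exact (norm_sub_le _ _).trans (add_le_add (key x hxb) (key x₀ (lt_add_one _)))
  · exact integrable_const _
  · refine Eventually.of_forall fun y => ?_
    have hc : ContinuousAt (fun x => Axv x y w) x₀ := by
      have h1 : ContinuousAt (fun p : ℝ × ℝ => Axv p.1 p.2 w) (x₀, y) :=
        (Axv_cont hw).continuousAt (((UU_open w).prod isOpen_univ).mem_nhds ⟨hU, mem_univ _⟩)
      exact ContinuousAt.comp (f := fun x : ℝ => (x, y)) h1 (by fun_prop)
    have h3 := ((hc.tendsto.sub_const (Axv x₀ y w)).norm.pow 2)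
    rwa [sub_self, norm_zero, zero_pow two_ne_zero] at h3

/-! ### The diagonal -/

/-- diagonal integrand -/
def fdg (w : ℂ) (x s : ℝ) : ℂ := (Gf w x s - Dv w x s) * Gf w x s

/-- its derivative -/
def fdg1 (w : ℂ) (x s : ℝ) : ℂ :=
  (Psi1 w x s - Dv1 w x s) * Gf w x s + (Gf w x s - Dv w x s) * Psi1 w x s

/-- diagonal derivative -/
def ddg (w : ℂ) (x : ℝ) : ℂ :=
  fdg w x x + (∫ s in (0:ℝ)..x, fdg1 w x s) - (ac w + 2 * Psi1 w x x)

lemma Av_diag {w : ℂ} (hw : 0 < w.re) {x : ℝ} (hx : 0 ≤ x) :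
    Av x x w = (∫ s in (0:ℝ)..x, fdg w x s) - Gf w x x := by
  have h := congrArg (fun g : EE => g x) (Dv_fix hw hx)
  rw [Jop_eval] at h
  unfold Av
  rw [Gf_eq hw hx le_rfl, h]
  congr 1
  refine intervalIntegral.integral_congr fun s hs => ?_
  rw [uIcc_of_le hx] at hs
  simp only [BoundedContinuousFunction.coe_sub, Pi.sub_apply, fdg]
  rw [psi_apply hw, psi_apply hw, Phi_symm s x, Gf_eq hw hs.1 hs.2]

lemma fdg_contOn {w : ℂ} (hw : 0 < w.re) :
    ContinuousOn (fun p : ℝ × ℝ => fdg w p.1 p.2) (UU w ×ˢ univ) := by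
  have h1 := (Gf_cont hw).continuousOn (s := UU w ×ˢ univ)
  exact (h1.sub (eval_cont (Dv_cont hw))).mul h1

lemma fdg1_contOn {w : ℂ} (hw : 0 < w.re) :
    ContinuousOn (fun p : ℝ × ℝ => fdg1 w p.1 p.2) (UU w ×ˢ univ) := by
  have h1 := (Gf_cont hw).continuousOn (s := UU w ×ˢ univ)
  have h2 := (Psi1_cont hw).continuousOn (s := UU w ×ˢ univ)
  exact ((h2.sub (eval_cont (Dv1_cont hw))).mul h1).add ((h1.sub (eval_cont (Dv_cont hw))).mul h2)

lemma Av_diag_deriv {w : ℂ} (hw : 0 < w.re) {x : ℝ} (hx : 0 ≤ x) :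
    HasDerivWithinAt (fun t => Av t t w) (ddg w x) (Ici 0) x := by
  have h1 := leibniz (UU_open w) (fdg_contOn hw) (fdg1_contOn hw) (fun x hx s =>
    ((Gf_deriv hw x s).sub (eval_deriv (Dv_deriv hw hx) s)).mul (Gf_deriv hw x s)) (UU_mem hw hx)
  have h2 : HasDerivAt (fun t => Gf w t t) (ac w + 2 * Psi1 w x x) x := by
    unfold Gf
    refine HasDerivAt.add ?_ (Psi_diag_deriv hw x)
    have := (Complex.ofRealCLM.hasDerivAt (x := x)).const_mul (ac w)
    simpa using this
  exact (h1.sub h2).hasDerivWithinAt.congr (fun t ht => Av_diag hw ht) (Av_diag hw hx)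

lemma ddg_cont {w : ℂ} (hw : 0 < w.re) : ContinuousOn (ddg w) (Ici 0) := by
  have hg : Continuous fun p : ℝ × ℝ => fdg1 w (max p.1 0) p.2 := by
    rw [← continuousOn_univ]
    refine (fdg1_contOn hw).comp (f := fun p : ℝ × ℝ => (max p.1 0, p.2)) ?_ ?_
    · fun_prop
    · intro p _
      exact ⟨UU_mem hw (le_max_right _ _), mem_univ _⟩
  have h1 : Continuous fun x => ∫ s in (0:ℝ)..x, fdg1 w (max x 0) s :=
    intervalIntegral.continuous_parametric_intervalIntegral_of_continuous
      (f := fun x s => fdg1 w (max x 0) s) hg continuous_id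
  have h2 : ContinuousOn (fun x => fdg w x x) (Ici 0) :=
    (fdg_contOn hw).comp (f := fun x : ℝ => (x, x)) (by fun_prop)
      (fun x hx => ⟨UU_mem hw hx, mem_univ _⟩)
  have h3 : Continuous fun x => ac w + 2 * Psi1 w x x := by
    have := Psi1_cont hw
    have h4 : Continuous fun x : ℝ => Psi1 w x x := this.comp (continuous_id.prodMk continuous_id)
    fun_prop
  refine ((h2.add h1.continuousOn).sub h3.continuousOn).congr fun x hx => ?_
  have : max x 0 = x := max_eq_left hx
  simp only [ddg, this, Pi.add_apply, Pi.sub_apply]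

lemma Av_derivWithin {w : ℂ} (hw : 0 < w.re) {x : ℝ} (hx : 0 ≤ x) :
    derivWithin (fun t : ℝ => Av t t w) (Ici 0) x = ddg w x :=
  (Av_diag_deriv hw hx).derivWithin (uniqueDiffOn_Ici 0 x hx)

/-! ### Holomorphy -/

lemma deriv_of_taylor {E : Type*} [NormedAddCommGroup E] [NormedSpace ℂ E] {f : ℂ → E} {d : E}
    {r : ℂ → E} {C : ℝ} {w : ℂ} {S : Set ℂ} (hS : S ∈ nhds w)
    (h : ∀ w' ∈ S, f w' - f w - (w' - w) • d = (w' - w) ^ 2 • r w')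
    (hr : ∀ w' ∈ S, ‖r w'‖ ≤ C) : HasDerivAt f d w := by
  rw [hasDerivAt_iff_isLittleO]
  have h1 : (fun w' => f w' - f w - (w' - w) • d) =O[nhds w] fun w' => (w' - w) ^ 2 := by
    refine Asymptotics.IsBigO.of_bound C ?_
    filter_upwards [hS] with w' hw'
    rw [h w' hw', norm_smul, mul_comm]
    gcongr
    exact hr w' hw'
  refine h1.trans_isLittleO ?_
  have h2 : (fun w' : ℂ => w' - w) =o[nhds w] fun _ => (1:ℂ) := by
    rw [Asymptotics.isLittleO_one_iff]
    have : Continuous fun w' : ℂ => w' - w := by fun_prop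
    simpa using this.tendsto w
  have h3 := (Asymptotics.isBigO_refl (fun w' : ℂ => w' - w) (nhds w)).mul_isLittleO h2
  simpa [sq] using h3

lemma half_nhds {w : ℂ} (hw : 0 < w.re) : {z : ℂ | 0 < z.re} ∈ nhds w :=
  (isOpen_lt continuous_const Complex.continuous_re).mem_nhds hw

lemma psi_holo {w : ℂ} (hw : 0 < w.re) (x : ℝ) :
    HasDerivAt (fun z => psi z x) (kerE (mw1 w) x) w :=
  deriv_of_taylor (half_nhds hw) (fun _ hw' => ker_taylor hw hw' x)
    (fun _ hw' => ker_norm (wt_mw2 hw hw') x)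

lemma Jop_taylor {w : ℂ} (hw : 0 < w.re) {w' : ℂ} (hw' : 0 < w'.re) (x : ℝ) :
    Jop (psi w') x - Jop (psi w) x - (w' - w) • Jop (kerE (mw1 w)) x =
      (w' - w) ^ 2 • Jop (kerE (mw2 w w')) x := by
  refine ContinuousLinearMap.ext fun h => ?_
  change Jop (psi w') x h - Jop (psi w) x h - (w' - w) • Jop (kerE (mw1 w)) x h =
      (w' - w) ^ 2 • Jop (kerE (mw2 w w')) x h
  simp only [Jop_apply]
  have c1 : Continuous fun s => h s • psi w' s - h s • psi w s :=
    (hpsi_cont _ h).sub (hpsi_cont _ h)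
  have c2 : Continuous fun s => (w' - w) • h s • kerE (mw1 w) s :=
    (continuous_const_smul (w' - w)).comp (hpsi_cont (kerE (mw1 w)) h)
  rw [← intervalIntegral.integral_smul, ← intervalIntegral.integral_smul,
    ← intervalIntegral.integral_sub (hpsi_ii _ h _ _) (hpsi_ii _ h _ _),
    ← intervalIntegral.integral_sub (c1.intervalIntegrable _ _) (c2.intervalIntegrable _ _)]
  refine intervalIntegral.integral_congr fun s _ => ?_
  rw [smul_comm ((w' - w) ^ 2), ← ker_taylor hw hw' s, smul_comm (w' - w), smul_sub, smul_sub]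

lemma Jop_holo {w : ℂ} (hw : 0 < w.re) {x : ℝ} (hx : 0 ≤ x) :
    HasDerivAt (fun z => Jop (psi z) x) (Jop (kerE (mw1 w)) x) w := by
  have hk := kap_nonneg
  refine deriv_of_taylor (E := EE →L[ℂ] EE) (f := fun z => Jop (psi z) x)
    (d := Jop (kerE (mw1 w)) x) (r := fun w' => Jop (kerE (mw2 w w')) x)
    (half_nhds hw) (fun _ hw' => Jop_taylor hw hw' x)
    (C := (2 * ((1 + 1 / Real.sqrt w.re) / w.re) * kap * Real.sqrt x) * |x|) (fun w' hw' => ?_)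
  refine Jop_norm _ _ (by positivity) fun s hs => ?_
  rw [uIoc_of_le hx] at hs
  refine (ker_norm (wt_mw2 hw hw') s).trans ?_
  rw [abs_of_pos hs.1]
  gcongr
  exact hs.2

lemma inv_diff {E : Type*} [NormedAddCommGroup E] [NormedSpace ℂ E] [CompleteSpace E]
    {f : ℂ → E →L[ℂ] E} {w : ℂ} (hf : DifferentiableAt ℂ f w) {g : ℂ → E}
    (hg : DifferentiableAt ℂ g w) (hu : IsUnit (1 + f w)) :
    DifferentiableAt ℂ (fun z => Ring.inverse (1 + f z) (g z)) w := by
  have h1 : DifferentiableAt ℂ (Ring.inverse : (E →L[ℂ] E) → _) (1 + f w) :=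
    differentiableAt_inverse hu
  have h2 : DifferentiableAt ℂ (fun z => 1 + f z) w := hf.const_add 1
  have h3 : DifferentiableAt ℂ (fun z => Ring.inverse (1 + f z)) w :=
    DifferentiableAt.comp (f := fun z => 1 + f z) w h1 h2
  exact h3.clm_apply hg

lemma Av_holo {x : ℝ} (hx : 0 ≤ x) (y : ℝ) :
    DifferentiableOn ℂ (fun w => Av x y w) {w : ℂ | 0 < w.re} := by
  intro w hw
  have hw : 0 < w.re := hw
  have h1 : DifferentiableAt ℂ (fun z => Vv z x (psi z x)) w :=
    inv_diff (Jop_holo hw hx).differentiableAt (psi_holo hw x).differentiableAt (UU_mem hw hx)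
  let T : EE →L[ℂ] ℂ := BoundedContinuousFunction.evalCLM ℂ y
  have h2 : DifferentiableAt ℂ (fun z => - T (Vv z x (psi z x))) w :=
    (T.differentiableAt.comp w h1).neg
  exact h2.differentiableWithinAt.congr (fun z hz => Av_eq hz hx y) (Av_eq hw hx y)

/-! ### Bounds -/

lemma pow_up {q c : ℝ} (hq : 1 ≤ q) (hc : 0 ≤ c) {m n : ℕ} (h : m ≤ n) : c * q ^ m ≤ c * q ^ n := by
  gcongr

lemma bounds {X : ℝ} (hX : 1 ≤ X) : ∃ C : ℝ, 0 < C ∧ ∀ w : ℂ, 0 < w.re → ∀ x : ℝ, 0 ≤ x → x ≤ X →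
    (∀ y, ‖Av x y w‖ ≤ C * (1 + ‖w‖) ^ 6) ∧
    (∀ y, 0 ≤ y → y ≤ x → ‖Axv x y w‖ ≤ C * (1 + ‖w‖) ^ 6) ∧
    ‖ddg w x‖ ≤ C * (1 + ‖w‖) ^ 6 := by
  have hk := kap_nonneg
  have hB := Bm_nonneg
  obtain ⟨c0, hc0, hc0e⟩ : ∃ c0 : ℝ, 0 ≤ c0 ∧ c0 = 2 * kap * Real.sqrt X := ⟨_, by positivity, rfl⟩
  obtain ⟨ca, hca, hcae⟩ : ∃ ca : ℝ, 0 ≤ ca ∧ ca = |Jn 1 / Real.pi| := ⟨_, by positivity, rfl⟩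
  obtain ⟨c1, hc1, hc1e⟩ : ∃ c1 : ℝ, 0 ≤ c1 ∧ c1 = 1 + c0 * X := ⟨_, by positivity, rfl⟩
  obtain ⟨c2, hc2, hc2e⟩ : ∃ c2 : ℝ, 0 ≤ c2 ∧ c2 = X * Bm := ⟨_, by positivity, rfl⟩
  obtain ⟨c3, hc3, hc3e⟩ : ∃ c3 : ℝ, 0 ≤ c3 ∧ c3 = c0 * c0 + c2 * c0 * X := ⟨_, by positivity, rfl⟩
  obtain ⟨c4, hc4, hc4e⟩ : ∃ c4 : ℝ, 0 ≤ c4 ∧ c4 = c0 + c1 * c0 := ⟨_, by positivity, rfl⟩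
  obtain ⟨c5, hc5, hc5e⟩ : ∃ c5 : ℝ, 0 ≤ c5 ∧ c5 = c1 * (c3 + c4 * c0) := ⟨_, by positivity, rfl⟩
  obtain ⟨c6, hc6, hc6e⟩ : ∃ c6 : ℝ, 0 ≤ c6 ∧
    c6 = (c0 + c4) * c0 + ((c2 + c5) * c0 + (c0 + c4) * c2) * X + (ca + 2 * c2) := ⟨_, by positivity, rfl⟩
  refine ⟨1 + c1 * c0 + (c5 + c2) + c6, by positivity, fun w hw x hx hxX => ?_⟩
  set q : ℝ := 1 + ‖w‖ with hqd
  have hq : 1 ≤ q := by rw [hqd]; linarith [norm_nonneg w]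
  have hq0 : 0 ≤ q := by linarith
  have bpsi : ∀ s, 0 ≤ s → s ≤ x → ‖psi w s‖ ≤ c0 * q := by
    intro s h0 h1
    refine (psi_norm_le hw h0 (h1.trans hxX)).trans (le_of_eq ?_)
    rw [hc0e]; ring
  have bV : ‖Vv w x‖ ≤ c1 * q := by
    refine (Vv_main hw hx hxX).2.trans ?_
    rw [hc1e, hc0e]
    nlinarith
  have bac : ‖ac w‖ ≤ ca * q := by
    unfold ac
    rw [norm_mul, Complex.norm_real, Real.norm_eq_abs, ← hcae, mul_comm]
    gcongr
    rw [hqd]; linarith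
  have bPsi : ∀ s, 0 ≤ s → s ≤ x → ‖Psi1 w x s‖ ≤ c2 * q ^ 2 := by
    intro s h0 h1
    refine (Psi1_bound hw x s).trans ?_
    rw [abs_of_nonneg h0, hc2e]
    calc s * (q ^ 2 * Bm) ≤ X * (q ^ 2 * Bm) := by gcongr; linarith
      _ = _ := by ring
  have bG : ∀ s, 0 ≤ s → s ≤ x → ‖Gf w x s‖ ≤ c0 * q := by
    intro s h0 h1
    rw [← Gf_eq hw h0 h1, ← psi_apply hw]
    exact ((psi w x).norm_coe_le_norm s).trans (bpsi x hx le_rfl)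
  have bpx := bpsi x hx le_rfl
  have bVp : ‖Vv w x (psi w x)‖ ≤ c1 * c0 * q ^ 2 :=
    calc _ ≤ ‖Vv w x‖ * ‖psi w x‖ := (Vv w x).le_opNorm _
      _ ≤ (c1 * q) * (c0 * q) := by gcongr
      _ = _ := by ring
  have bD : ‖Dv w x‖ ≤ c4 * q ^ 2 := by
    rw [Dv_eq hw hx]
    refine (norm_sub_le _ _).trans ?_
    rw [hc4e, add_mul]
    refine add_le_add (bpx.trans ?_) bVp
    simpa using pow_up hq hc0 (show 1 ≤ 2 by norm_num)
  have bDe : ∀ s, ‖Dv w x s‖ ≤ c4 * q ^ 2 := fun s => ((Dv w x).norm_coe_le_norm s).trans bD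
  have bR1 : ‖Rv1 w x‖ ≤ c3 * q ^ 3 := by
    unfold Rv1
    refine (norm_add_le _ _).trans ?_
    rw [hc3e, add_mul]
    refine add_le_add ?_ ?_
    · rw [norm_smul]
      calc _ ≤ (c0 * q) * (c0 * q) := by
            gcongr
            exact bG x hx le_rfl
        _ = c0 * c0 * q ^ 2 := by ring
        _ ≤ _ := pow_up hq (by positivity) (by norm_num)
    · have := intervalIntegral.norm_integral_le_of_norm_le_const (a := 0) (b := x)
        (f := fun s => Psi1 w x s • psi w s) (C := c2 * c0 * q ^ 3) (fun s hs => by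
          rw [uIoc_of_le hx] at hs
          rw [norm_smul]
          calc _ ≤ (c2 * q ^ 2) * (c0 * q) := by
                gcongr
                · exact bPsi s hs.1.le hs.2
                · exact bpsi s hs.1.le hs.2
            _ = _ := by ring)
      refine this.trans ?_
      rw [sub_zero, abs_of_nonneg hx]
      calc c2 * c0 * q ^ 3 * x ≤ c2 * c0 * q ^ 3 * X := by gcongr
        _ = _ := by ring
  have bD1 : ‖Dv1 w x‖ ≤ c5 * q ^ 4 := by
    unfold Dv1
    calc _ ≤ ‖Vv w x‖ * ‖Rv1 w x - (Dv w x x) • psi w x‖ := (Vv w x).le_opNorm _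
      _ ≤ (c1 * q) * (c3 * q ^ 3 + (c4 * q ^ 2) * (c0 * q)) := by
          gcongr
          refine (norm_sub_le _ _).trans (add_le_add bR1 ?_)
          rw [norm_smul]
          gcongr
          exact bDe x
      _ = _ := by rw [hc5e]; ring
  have bD1e : ∀ s, ‖Dv1 w x s‖ ≤ c5 * q ^ 4 := fun s => ((Dv1 w x).norm_coe_le_norm s).trans bD1
  refine ⟨fun y => ?_, fun y hy hyx => ?_, ?_⟩
  · rw [Av_eq hw hx, norm_neg]
    refine ((Vv w x (psi w x)).norm_coe_le_norm y).trans (bVp.trans ?_)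
    refine (pow_up hq (by positivity) (show 2 ≤ 6 by norm_num)).trans ?_
    gcongr
    linarith
  · refine (norm_sub_le _ _).trans ((add_le_add (bD1e y) (bPsi y hy hyx)).trans ?_)
    have h1 := pow_up hq hc5 (show 4 ≤ 6 by norm_num)
    have h2 := pow_up hq hc2 (show 2 ≤ 6 by norm_num)
    have h3 : 0 ≤ (1 + c1 * c0 + c6) * q ^ 6 := by positivity
    nlinarith
  · have bdiff : ∀ s, 0 ≤ s → s ≤ x → ‖Gf w x s - Dv w x s‖ ≤ (c0 + c4) * q ^ 2 := by
      intro s h0 h1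
      refine (norm_sub_le _ _).trans ((add_le_add (bG s h0 h1) (bDe s)).trans ?_)
      have := pow_up hq hc0 (show 1 ≤ 2 by norm_num)
      rw [pow_one] at this
      linarith
    have t1 : ‖fdg w x x‖ ≤ (c0 + c4) * c0 * q ^ 6 := by
      unfold fdg
      rw [norm_mul]
      calc _ ≤ ((c0 + c4) * q ^ 2) * (c0 * q) := by
            gcongr
            · exact bdiff x hx le_rfl
            · exact bG x hx le_rfl
        _ = (c0 + c4) * c0 * q ^ 3 := by ring
        _ ≤ _ := pow_up hq (by positivity) (by norm_num)
    have t2 : ∀ s, 0 ≤ s → s ≤ x → ‖fdg1 w x s‖ ≤ ((c2 + c5) * c0 + (c0 + c4) * c2) * q ^ 6 := by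
      intro s h0 h1
      unfold fdg1
      refine (norm_add_le _ _).trans ?_
      rw [add_mul, norm_mul, norm_mul]
      refine add_le_add ?_ ?_
      · calc _ ≤ (c2 * q ^ 2 + c5 * q ^ 4) * (c0 * q) := by
              gcongr
              · exact (norm_sub_le _ _).trans (add_le_add (bPsi s h0 h1) (bD1e s))
              · exact bG s h0 h1
          _ ≤ (c2 * q ^ 4 + c5 * q ^ 4) * (c0 * q) := by
              gcongr
              norm_num
          _ = (c2 + c5) * c0 * q ^ 5 := by ring
          _ ≤ _ := pow_up hq (by positivity) (by norm_num)
      · calc _ ≤ ((c0 + c4) * q ^ 2) * (c2 * q ^ 2) := by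
              gcongr
              · exact bdiff s h0 h1
              · exact bPsi s h0 h1
          _ = (c0 + c4) * c2 * q ^ 4 := by ring
          _ ≤ _ := pow_up hq (by positivity) (by norm_num)
    have t3 : ‖∫ s in (0:ℝ)..x, fdg1 w x s‖ ≤ ((c2 + c5) * c0 + (c0 + c4) * c2) * X * q ^ 6 := by
      have := intervalIntegral.norm_integral_le_of_norm_le_const (a := 0) (b := x)
        (f := fun s => fdg1 w x s) (C := ((c2 + c5) * c0 + (c0 + c4) * c2) * q ^ 6) (fun s hs => by
          rw [uIoc_of_le hx] at hs
          exact t2 s hs.1.le hs.2)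
      refine this.trans ?_
      rw [sub_zero, abs_of_nonneg hx]
      calc _ ≤ ((c2 + c5) * c0 + (c0 + c4) * c2) * q ^ 6 * X := by gcongr
        _ = _ := by ring
    have t4 : ‖ac w + 2 * Psi1 w x x‖ ≤ (ca + 2 * c2) * q ^ 6 := by
      refine (norm_add_le _ _).trans ?_
      rw [norm_mul, Complex.norm_ofNat]
      have h1 := pow_up hq hca (show 1 ≤ 6 by norm_num)
      have h2 := pow_up hq hc2 (show 2 ≤ 6 by norm_num)
      have h3 := bPsi x hx le_rfl
      rw [pow_one] at h1
      linarith
    have t5 : ‖ddg w x‖ ≤ c6 * q ^ 6 := by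
      unfold ddg
      refine (norm_sub_le _ _).trans ?_
      have := norm_add_le (fdg w x x) (∫ s in (0:ℝ)..x, fdg1 w x s)
      rw [hc6e]
      linarith
    refine t5.trans ?_
    have h3 : 0 ≤ (1 + c1 * c0 + (c5 + c2)) * q ^ 6 := by positivity
    linarith

/-- **Full regularity and polynomial growth of the solution `A` of the integral equation.**
There is a kernel `A(x,y,w)` (with `x`-derivative kernel `Ax`) solving
`A + ∫₀^x A(x,s,w)Φ(s,y,w) ds + Φ(x,y,w) = 0` for all `0 ≤ y ≤ x` and `Re w > 0`, which is
continuous on `Δ = {0 ≤ y ≤ x}`, holomorphic in `w`; the map `x ↦ A(x,·,w) ∈ L²([0,x])` is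
continuously differentiable (difference quotients converge to `Ax` in `L²`, which varies
`L²`-continuously), the diagonal `x ↦ A(x,x,w)` is continuously differentiable, and `A`,
its `L²`-valued `x`-derivative and `d/dx A(x,x,w)` are all bounded by `C(X)(1+|w|)^α` on
`{0 ≤ y ≤ x ≤ X}`, with `α` independent of `X`. -/
theorem stmt_16 :
    ∃ A Ax : ℝ → ℝ → ℂ → ℂ, ∃ α : ℝ, 0 ≤ α ∧
      (∀ w : ℂ, 0 < w.re →
        -- the integral equation, satisfied for all (x,y) ∈ Δ
        (∀ x y : ℝ, 0 ≤ y → y ≤ x →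
          A x y w + (∫ s in (0:ℝ)..x, A x s w * Phi s y w) + Phi x y w = 0) ∧
        -- continuity on Δ
        ContinuousOn (fun p : ℝ × ℝ => A p.1 p.2 w)
          {p : ℝ × ℝ | 0 ≤ p.2 ∧ p.2 ≤ p.1} ∧
        -- x ↦ A(x,·,w) ∈ L²_y([0,x]) is differentiable with derivative Ax,
        -- continuously in x
        (∀ x₀ : ℝ, 0 < x₀ →
          Tendsto (fun h : ℝ =>
              ∫ y in Ioc (0:ℝ) x₀,
                ‖(A (x₀ + h) y w - A x₀ y w) / (h : ℂ) - Ax x₀ y w‖ ^ 2)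
            (nhdsWithin 0 {0}ᶜ) (nhds 0) ∧
          Tendsto (fun x' : ℝ =>
              ∫ y in Ioc (0:ℝ) x₀, ‖Ax x' y w - Ax x₀ y w‖ ^ 2)
            (nhds x₀) (nhds 0)) ∧
        -- the diagonal x ↦ A(x,x,w) is continuously differentiable
        (∀ x ∈ Ici (0:ℝ),
          DifferentiableWithinAt ℝ (fun t : ℝ => A t t w) (Ici 0) x) ∧
        ContinuousOn (fun x : ℝ => derivWithin (fun t : ℝ => A t t w) (Ici 0) x)
          (Ici 0)) ∧
      -- holomorphy in w
      (∀ x y : ℝ, 0 ≤ y → y ≤ x →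
        DifferentiableOn ℂ (fun w => A x y w) {w : ℂ | 0 < w.re}) ∧
      -- polynomial bounds, with exponent α independent of X
      ∀ X : ℝ, 1 ≤ X → ∃ C : ℝ, 0 < C ∧ ∀ w : ℂ, 0 < w.re →
        (∀ x y : ℝ, 0 ≤ y → y ≤ x → x ≤ X → ‖A x y w‖ ≤ C * (1 + ‖w‖) ^ α) ∧
        (∀ x : ℝ, 0 ≤ x → x ≤ X →
          (∫ y in Ioc (0:ℝ) x, ‖Ax x y w‖ ^ 2) ≤ (C * (1 + ‖w‖) ^ α) ^ 2) ∧
        (∀ x : ℝ, 0 ≤ x → x ≤ X →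
          ‖derivWithin (fun t : ℝ => A t t w) (Ici 0) x‖ ≤ C * (1 + ‖w‖) ^ α) := by
  refine ⟨Av, Axv, ((6 : ℕ) : ℝ), by positivity, ?_, ?_, ?_⟩
  · intro w hw
    refine ⟨fun x y hy hyx => Av_equation hw (hy.trans hyx) y, ?_, ?_, ?_, ?_⟩
    · exact (Av_cont hw).mono fun p hp => ⟨UU_mem hw (hp.1.trans hp.2), mem_univ _⟩
    · exact fun x₀ hx => ⟨Av_L2 hw hx, Axv_L2 hw hx⟩
    · exact fun x hx => (Av_diag_deriv hw hx).differentiableWithinAt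
    · exact (ddg_cont hw).congr fun x hx => Av_derivWithin hw hx
  · exact fun x y hy hyx => Av_holo (hy.trans hyx) y
  · intro X hX
    obtain ⟨C, hC, hb⟩ := bounds hX
    refine ⟨C * X, by positivity, fun w hw => ?_⟩
    simp only [Real.rpow_natCast]
    have hle : C * (1 + ‖w‖) ^ 6 ≤ C * X * (1 + ‖w‖) ^ 6 := by
      gcongr
      nlinarith
    refine ⟨fun x y hy hyx hxX => ?_, fun x hx hxX => ?_, fun x hx hxX => ?_⟩
    · exact ((hb w hw x (hy.trans hyx) hxX).1 y).trans hle
    · have h1 := (hb w hw x hx hxX).2.1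
      have h2 : ‖∫ y in Ioc (0:ℝ) x, ‖Axv x y w‖ ^ 2‖ ≤ (C * (1 + ‖w‖) ^ 6) ^ 2 *
          (volume : Measure ℝ).real (Ioc 0 x) := by
        refine norm_setIntegral_le_of_norm_le_const (by simp) fun y hy => ?_
        rw [Real.norm_of_nonneg (by positivity)]
        have := h1 y hy.1.le hy.2
        gcongr
      rw [Real.volume_real_Ioc_of_le hx, sub_zero] at h2
      refine (le_abs_self _).trans (h2.trans ?_)
      have h3 : x ≤ X ^ 2 := by nlinarith
      calc _ ≤ (C * (1 + ‖w‖) ^ 6) ^ 2 * X ^ 2 := by gcongr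
        _ = _ := by ring
    · rw [Av_derivWithin hw hx]
      exact ((hb w hw x hx hxX).2.2).trans hle


end
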